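/- arXiv:1203.6434 — 15 statements merged into one kernel-verified Lean document; each statement's English description precedes it below -/
import Mathlib

section
/- Let J be a commutative (not necessarily associative) ℝ-algebra satisfying the Jordan identity x(x²y) = x²(xy) for all x, y ∈ J. For u, v ∈ J define S_{uv} := L_uL_v − L_vL_u + L_{uv} ∈ End(J), where L_u is left multiplication by u. Then for all u, v, z, w ∈ J: S_{uv}S_{zw} − S_{zw}S_{uv} = S_{S_{uv}(z), w} − S_{z, S_{vu}(w)}. -/
/-- The linearized Jordan identity `[L_a, L_{bc}] + [L_b, L_{ca}] + [L_c, L_{ab}] = 0`,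
evaluated at `d`. -/
theorem jordan_linearized {J : Type*} [NonUnitalNonAssocCommRing J] [Module ℝ J]
    (jordan : ∀ x y : J, x * (x * x * y) = x * x * (x * y)) (a b c d : J) :
    a * (b * c * d) + b * (c * a * d) + c * (a * b * d)
      = b * c * (a * d) + c * a * (b * d) + a * b * (c * d) := by
  let := IsCommJordan.mk (A := J) fun x y => by
    rw [mul_comm (x * y), mul_comm y, jordan, mul_comm (x * x)]
  have h : (2 : ℝ) • (a * (b * c * d) - b * c * (a * d) + (b * (c * a * d) - c * a * (b * d))
      + (c * (a * b * d) - a * b * (c * d))) = 0 := by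
    rw [ofNat_smul_eq_nsmul]
    exact DFunLike.congr_fun (two_nsmul_lie_lmul_lmul_add_add_eq_zero a b c) d
  rw [smul_eq_zero_iff_right two_ne_zero] at h
  rw [← sub_eq_zero, ← h]
  abel

/-- Commutators of multiplications are derivations of a Jordan algebra. -/
theorem jordan_lie_mulLeft_mul {J : Type*} [NonUnitalNonAssocCommRing J] [Module ℝ J]
    (jordan : ∀ x y : J, x * (x * x * y) = x * x * (x * y)) (u v c d : J) :
    u * (v * (c * d)) - v * (u * (c * d))
      = (u * (v * c) - v * (u * c)) * d + c * (u * (v * d) - v * (u * d)) := by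
  have h₁ := jordan_linearized jordan u c d v
  have h₂ := jordan_linearized jordan v c d u
  simp only [mul_sub, sub_mul]
  grind [mul_comm]

/-- For a real Jordan algebra `J` (a commutative, not necessarily associative
ℝ-algebra satisfying the Jordan identity `x(x²y) = x²(xy)`), the operators
`S_{uv} = [L_u, L_v] + L_{uv}` satisfy
`[S_{uv}, S_{zw}] = S_{S_{uv}(z), w} − S_{z, S_{vu}(w)}`. -/
theorem stmt1 (J : Type*) [NonUnitalNonAssocCommRing J] [Module ℝ J]
    [SMulCommClass ℝ J J] [IsScalarTower ℝ J J]
    (jordan : ∀ x y : J, x * (x * x * y) = x * x * (x * y))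
    (S : J → J → Module.End ℝ J)
    (hS : ∀ u v, S u v = LinearMap.mulLeft ℝ u * LinearMap.mulLeft ℝ v
      - LinearMap.mulLeft ℝ v * LinearMap.mulLeft ℝ u + LinearMap.mulLeft ℝ (u * v)) :
    ∀ u v z w : J, S u v * S z w - S z w * S u v = S (S u v z) w - S z (S v u w) := by
  intro u v z w
  have hH (a b c : J) :
      LinearMap.mulLeft ℝ a * LinearMap.mulLeft ℝ (b * c)
          - LinearMap.mulLeft ℝ (b * c) * LinearMap.mulLeft ℝ a
        + (LinearMap.mulLeft ℝ b * LinearMap.mulLeft ℝ (c * a)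
          - LinearMap.mulLeft ℝ (c * a) * LinearMap.mulLeft ℝ b)
        + (LinearMap.mulLeft ℝ c * LinearMap.mulLeft ℝ (a * b)
          - LinearMap.mulLeft ℝ (a * b) * LinearMap.mulLeft ℝ c) = 0 := by
    ext d
    have := jordan_linearized jordan a b c d
    simp only [LinearMap.add_apply, LinearMap.sub_apply, Module.End.mul_apply,
      LinearMap.mulLeft_apply, LinearMap.zero_apply]
    rw [← sub_eq_zero] at this
    rw [← this]
    abel
  have hD (a b c : J) :
      (LinearMap.mulLeft ℝ a * LinearMap.mulLeft ℝ b - LinearMap.mulLeft ℝ b * LinearMap.mulLeft ℝ a)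
          * LinearMap.mulLeft ℝ c
        - LinearMap.mulLeft ℝ c
          * (LinearMap.mulLeft ℝ a * LinearMap.mulLeft ℝ b - LinearMap.mulLeft ℝ b * LinearMap.mulLeft ℝ a)
      = LinearMap.mulLeft ℝ (a * (b * c) - b * (a * c)) := by
    ext d
    have := jordan_lie_mulLeft_mul jordan a b c d
    simp only [LinearMap.sub_apply, Module.End.mul_apply, LinearMap.mulLeft_apply]
    rw [this]
    abel
  have hadd (a b : J) : LinearMap.mulLeft ℝ (a + b)
      = LinearMap.mulLeft ℝ a + LinearMap.mulLeft ℝ b := map_add (LinearMap.mul ℝ J) a b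
  have hsub (a b : J) : LinearMap.mulLeft ℝ (a - b)
      = LinearMap.mulLeft ℝ a - LinearMap.mulLeft ℝ b := map_sub (LinearMap.mul ℝ J) a b
  have huv : S u v z = (u * (v * z) - v * (u * z)) + u * v * z := by simp [hS]
  have hvu : S v u w = u * v * w - (u * (v * w) - v * (u * w)) := by
    simp only [hS, LinearMap.add_apply, LinearMap.sub_apply, Module.End.mul_apply,
      LinearMap.mulLeft_apply, mul_comm v u]
    abel
  rw [huv, hvu]
  have hz := hD u v z
  have hw := hD u v w
  have hzw := hD u v (z * w)
  have ha := hD z w (u * v)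
  have h := hH (u * v) z w
  rw [jordan_lie_mulLeft_mul jordan u v z w, hadd] at hzw
  rw [hsub, mul_comm w (u * v), mul_comm z (u * v), mul_comm z (u * v * w),
    mul_comm w (u * v * z)] at ha
  rw [mul_comm w (u * v)] at h
  generalize u * (v * z) - v * (u * z) = p at *
  generalize u * (v * w) - v * (u * w) = q at *
  simp only [hS, hadd, hsub, add_mul, mul_sub, mul_comm z (u * v * w)]
  generalize u * v = a at *
  linear_combination (norm := noncomm_ring) hz * LinearMap.mulLeft ℝ w
    - LinearMap.mulLeft ℝ w * hz + LinearMap.mulLeft ℝ z * hw - hw * LinearMap.mulLeft ℝ z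
    + hzw - ha + h
end

section
/- Let g be a Lie algebra over ℂ, let J be a finite-dimensional real Jordan algebra with unit e, let X, Y : J → g be ℝ-linear maps and S : J × J → g an ℝ-bilinear map such that for all u, v, z, w ∈ J: [X_u, X_v] = 0, [Y_u, Y_v] = 0, [X_u, Y_v] = −2S(u, v), [S(u,v), X_z] = X_{{uvz}}, [S(u,v), Y_z] = −Y_{{vuz}}, [S(u,v), S(z,w)] = S({uvz}, w) − S(z, {vuw}), and S(u, v) + S(v, u) = 2S(uv, e). Set L_u := S(u, e), E_u^± := iL_u ∓ (1/2)(X_u − Y_u) and h_u := −i(X_u + Y_u). Then for all u, v ∈ J: (1) [h_u, E_v^±] = ±2E_{uv}^±; (2) [E_u^+, E_v^−] = −h_{uv} − 2[L_u, L_v]; (3) [E_u^+, E_v^+] = 0 and [E_u^−, E_v^−] = 0; (4) [h_u, h_v] = 4[L_u, L_v]. -/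
/-- Given a complex Lie algebra `g` and ℝ-linear maps `X, Y : J → g`, ℝ-bilinear
`S : J × J → g` from a finite-dimensional real unital Jordan algebra `J` satisfying
the TKK relations (with `{uvz} = u(vz) − v(uz) + (uv)z`) together with
`S(u,v) + S(v,u) = 2S(uv, e)`, the elements `L_u := S(u,e)`,
`E_u^± := iL_u ∓ (1/2)(X_u − Y_u)`, `h_u := −i(X_u + Y_u)` satisfy
`[h_u, E_v^±] = ±2E_{uv}^±`, `[E_u^+, E_v^−] = −h_{uv} − 2[L_u, L_v]`,
`[E_u^±, E_v^±] = 0`, and `[h_u, h_v] = 4[L_u, L_v]`. -/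
theorem stmt4 {g : Type*} [LieRing g] [LieAlgebra ℂ g]
    {J : Type*} [NonUnitalNonAssocCommRing J] [Module ℝ J]
    [SMulCommClass ℝ J J] [IsScalarTower ℝ J J] [FiniteDimensional ℝ J]
    (jordan : ∀ x y : J, x * (x * x * y) = x * x * (x * y))
    (e : J) (he : ∀ x : J, e * x = x)
    (X Y : J →ₗ[ℝ] g) (S : J →ₗ[ℝ] J →ₗ[ℝ] g)
    (hXX : ∀ u v, ⁅X u, X v⁆ = 0)
    (hYY : ∀ u v, ⁅Y u, Y v⁆ = 0)
    (hXY : ∀ u v, ⁅X u, Y v⁆ = -((2 : ℂ) • S u v))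
    (hSX : ∀ u v z, ⁅S u v, X z⁆ = X (u * (v * z) - v * (u * z) + (u * v) * z))
    (hSY : ∀ u v z, ⁅S u v, Y z⁆ = -(Y (v * (u * z) - u * (v * z) + (v * u) * z)))
    (hSS : ∀ u v z w, ⁅S u v, S z w⁆
      = S (u * (v * z) - v * (u * z) + (u * v) * z) w
        - S z (v * (u * w) - u * (v * w) + (v * u) * w))
    (hSsym : ∀ u v, S u v + S v u = (2 : ℂ) • S (u * v) e)
    (L : J → g) (hL : ∀ u, L u = S u e)
    (Ep Em h : J → g)
    (hEp : ∀ u, Ep u = Complex.I • L u - (1 / 2 : ℂ) • (X u - Y u))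
    (hEm : ∀ u, Em u = Complex.I • L u + (1 / 2 : ℂ) • (X u - Y u))
    (hh : ∀ u, h u = -(Complex.I • (X u + Y u))) :
    ∀ u v : J,
      (⁅h u, Ep v⁆ = (2 : ℂ) • Ep (u * v)) ∧
      (⁅h u, Em v⁆ = -((2 : ℂ) • Em (u * v))) ∧
      (⁅Ep u, Em v⁆ = -(h (u * v)) - (2 : ℂ) • ⁅L u, L v⁆) ∧
      (⁅Ep u, Ep v⁆ = 0) ∧ (⁅Em u, Em v⁆ = 0) ∧
      (⁅h u, h v⁆ = (4 : ℂ) • ⁅L u, L v⁆) := by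
  have he' (x : J) : x * e = x := by rw [mul_comm, he]
  have hLX (u z : J) : ⁅S u e, X z⁆ = X (u * z) := by simp [hSX, he, he']
  have hLY (u z : J) : ⁅S u e, Y z⁆ = -Y (u * z) := by simp [hSY, he]
  have hXL (z u : J) : ⁅X z, S u e⁆ = -X (z * u) := by
    rw [← lie_skew, hLX, mul_comm]
  have hYL (z u : J) : ⁅Y z, S u e⁆ = Y (z * u) := by
    rw [← lie_skew, hLY, neg_neg, mul_comm]
  have hYX (u v : J) : ⁅Y u, X v⁆ = (2 : ℂ) • S v u := by
    rw [← lie_skew, hXY, neg_neg]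
  have hLL (u v : J) : ⁅S u e, S v e⁆ = S (u * v) e - S v u := by
    simp [hSS, he, he']
  intro u v
  have hS : S u v = (2 : ℂ) • S (u * v) e - S v u := eq_sub_of_add_eq (hSsym u v)
  have hI : Complex.I ^ 2 = -1 := Complex.I_sq
  refine ⟨?_, ?_, ?_, ?_, ?_, ?_⟩ <;>
  · simp only [hEp, hEm, hh, hL, lie_add, add_lie, lie_sub, sub_lie, lie_neg, neg_lie,
      lie_smul, smul_lie, hXX, hYY, hXY, hYX, hLX, hLY, hXL, hYL, hLL, hS]
    match_scalars <;> grind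
end

section
/- Let m ≥ 2, let η be the diagonal matrix indexed by {−1, 0, 1, …, m+1} with η_{−1,−1} = η_{00} = 1 and η_{jj} = −1 for 1 ≤ j ≤ m+1, and let A be a unital associative ℂ-algebra. Suppose (M_{μν}) is a family of elements of A with M_{μν} = −M_{νμ} satisfying the so(2, m+1) commutation relations [M_{ab}, M_{cd}] = −i(η_{bc}M_{ad} − η_{ac}M_{bd} − η_{bd}M_{ac} + η_{ad}M_{bc}). If Σ_{λ,κ} η^{λκ}(M_{0λ}M_{κ0} + M_{κ0}M_{0λ}) = c·1 for some constant c ∈ ℂ (here η^{λκ} is the inverse matrix of η, hence equal to η), then for all indices μ, ν one has Σ_{λ,κ} η^{λκ}(M_{μλ}M_{κν} + M_{κν}M_{μλ}) = c·η_{μν}·1. In other words, the single quadratic relation {M_{0λ}, M^λ_0} = c together with the commutation relations implies the full family of quadratic relations {M_{μλ}, M^λ_ν} = c·η_{μν}. -/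
/-- The metric `η = diag(1, 1, −1, …, −1)` for signature `(2, m+1)`.
The index set `Fin (m+3)` encodes `{−1, 0, 1, …, m+1}` (the first two indices,
corresponding to `μ = −1` and `μ = 0`, carry the `+1` sign); in particular the
index `⟨1, _⟩` encodes `μ = 0`. -/
noncomputable def etaDiag (m : ℕ) (μ : Fin (m + 3)) : ℂ :=
  if (μ : ℕ) < 2 then 1 else -1

/-- The matrix entries `η_{μν}`: diagonal with entries `etaDiag`.  Since the diagonal
entries are `±1`, the inverse matrix `η^{μν}` coincides with `η_{μν}`. -/
noncomputable def etaM (m : ℕ) (μ ν : Fin (m + 3)) : ℂ :=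
  if μ = ν then etaDiag m μ else 0

/-- The quadratic expression `{M_{μλ}, M^λ_ν}` with the contraction carried out. -/
noncomputable def anticommContraction {m : ℕ} {A : Type*} [Ring A] [Algebra ℂ A]
    (M : Fin (m + 3) → Fin (m + 3) → A) (μ ν : Fin (m + 3)) : A :=
  ∑ l, etaDiag m l • (M μ l * M l ν + M l ν * M μ l)

theorem etaDiag_mul_self (m : ℕ) (μ : Fin (m + 3)) : etaDiag m μ * etaDiag m μ = 1 := by
  unfold etaDiag
  split_ifs <;> norm_num

theorem sum_etaM_smul {m : ℕ} {A : Type*} [Ring A] [Algebra ℂ A] (l : Fin (m + 3))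
    (f : Fin (m + 3) → A) : ∑ k, etaM m l k • f k = etaDiag m l • f l := by
  simp [etaM]

theorem sum_etaDiag_mul_etaM_smul {m : ℕ} {A : Type*} [Ring A] [Algebra ℂ A] (b : Fin (m + 3))
    (f : Fin (m + 3) → A) : ∑ l, (etaDiag m l * etaM m b l) • f l = f b := by
  simp [etaM, etaDiag_mul_self]

theorem anticommContraction_symm {m : ℕ} {A : Type*} [Ring A] [Algebra ℂ A]
    {M : Fin (m + 3) → Fin (m + 3) → A} (hanti : ∀ μ ν, M μ ν = -M ν μ) (μ ν : Fin (m + 3)) :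
    anticommContraction M μ ν = anticommContraction M ν μ := by
  refine Finset.sum_congr rfl fun l _ => ?_
  rw [hanti μ l, hanti l ν, neg_mul_neg, neg_mul_neg, add_comm]

/-- The contraction `{M_{μλ}, M^λ_ν}` transforms as a tensor under `M_{ab}`. -/
theorem commutator_anticommContraction {m : ℕ} {A : Type*} [Ring A] [Algebra ℂ A]
    {M : Fin (m + 3) → Fin (m + 3) → A} (hanti : ∀ μ ν, M μ ν = -M ν μ)
    (hcomm : ∀ a b c d, M a b * M c d - M c d * M a b =
      (-Complex.I) • (etaM m b c • M a d - etaM m a c • M b d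
        - etaM m b d • M a c + etaM m a d • M b c))
    (a b μ ν : Fin (m + 3)) :
    M a b * anticommContraction M μ ν - anticommContraction M μ ν * M a b =
      (-Complex.I) • (etaM m b μ • anticommContraction M a ν
        - etaM m a μ • anticommContraction M b ν
        + etaM m b ν • anticommContraction M μ a
        - etaM m a ν • anticommContraction M μ b) := by
  have hcomm' : ∀ c d, M a b * M c d - M c d * M a b =
      (-Complex.I) • (etaM m b c • M a d - etaM m a c • M b d
        + etaM m b d • M c a - etaM m a d • M c b) := by
    intro c d
    rw [hcomm, hanti c a, hanti c b]
    module
  have leibniz : ∀ x y z : A, x * (y * z + z * y) - (y * z + z * y) * x =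
      (x * y - y * x) * z + z * (x * y - y * x) + y * (x * z - z * x) + (x * z - z * x) * y := by
    intro x y z
    noncomm_ring
  have cancel : ∑ l, ((etaDiag m l * etaM m b l) •
          (M μ a * M l ν + M l ν * M μ a + (M μ l * M a ν + M a ν * M μ l))
        - (etaDiag m l * etaM m a l) •
          (M μ b * M l ν + M l ν * M μ b + (M μ l * M b ν + M b ν * M μ l))) = 0 := by
    rw [Finset.sum_sub_distrib,
      sum_etaDiag_mul_etaM_smul b
        (fun l => M μ a * M l ν + M l ν * M μ a + (M μ l * M a ν + M a ν * M μ l)),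
      sum_etaDiag_mul_etaM_smul a
        (fun l => M μ b * M l ν + M l ν * M μ b + (M μ l * M b ν + M b ν * M μ l))]
    abel
  rw [← add_zero (etaM m b μ • _ - _ + _ - _), ← cancel]
  simp only [anticommContraction, Finset.mul_sum, Finset.sum_mul, Finset.smul_sum,
    ← Finset.sum_sub_distrib, ← Finset.sum_add_distrib]
  refine Finset.sum_congr rfl fun l _ => ?_
  rw [mul_smul_comm, smul_mul_assoc, ← smul_sub, leibniz, hcomm', hcomm']
  simp only [smul_mul_assoc, mul_smul_comm, mul_add, add_mul, mul_sub, sub_mul]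
  module

/-- Let `(M_{μν})` be an antisymmetric family in a unital associative ℂ-algebra
satisfying the `so(2, m+1)` commutation relations.  If the single quadratic relation
`Σ η^{λκ}(M_{0λ}M_{κ0} + M_{κ0}M_{0λ}) = c·1` holds, then the full family of quadratic
relations `Σ η^{λκ}(M_{μλ}M_{κν} + M_{κν}M_{μλ}) = c·η_{μν}·1` holds. -/
theorem stmt5 (m : ℕ) (hm : 2 ≤ m) (A : Type*) [Ring A] [Algebra ℂ A]
    (M : Fin (m + 3) → Fin (m + 3) → A)
    (hanti : ∀ μ ν, M μ ν = -M ν μ)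
    (hcomm : ∀ a b c d, M a b * M c d - M c d * M a b =
      (-Complex.I) • (etaM m b c • M a d - etaM m a c • M b d
        - etaM m b d • M a c + etaM m a d • M b c))
    (c : ℂ)
    (h0 : ∑ l, ∑ k, etaM m l k • (M ⟨1, by omega⟩ l * M k ⟨1, by omega⟩
        + M k ⟨1, by omega⟩ * M ⟨1, by omega⟩ l) = c • (1 : A)) :
    ∀ μ ν, ∑ l, ∑ k, etaM m l k • (M μ l * M k ν + M k ν * M μ l)
      = (c * etaM m μ ν) • (1 : A) := by
  have hQ : ∀ μ ν, ∑ l, ∑ k, etaM m l k • (M μ l * M k ν + M k ν * M μ l)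
      = anticommContraction M μ ν := fun μ ν =>
    Finset.sum_congr rfl fun l _ =>
      sum_etaM_smul l fun k => M μ l * M k ν + M k ν * M μ l
  have hsymm := anticommContraction_symm hanti
  have hbracket := commutator_anticommContraction hanti hcomm
  simp only [hQ] at h0 ⊢
  generalize ho : (⟨1, by omega⟩ : Fin (m + 3)) = o at h0
  have hoo : etaM m o o = 1 := by
    subst ho
    simp [etaM, etaDiag]
  have hne : ∀ {a b}, a ≠ b → etaM m a b = 0 := fun h => if_neg h
  have hmixed : ∀ a, a ≠ o → anticommContraction M a o = 0 := by
    intro a ha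
    have h := hbracket a o o o
    rw [h0, hoo, hne ha, hsymm o a, mul_smul_comm, smul_mul_assoc, mul_one, one_mul,
      sub_self] at h
    have h2 : (-Complex.I * 2) • anticommContraction M a o = 0 := by
      rw [h]
      module
    exact (smul_eq_zero_iff_right (by simp)).mp h2
  intro μ ν
  by_cases hμ : μ = o
  · by_cases hν : ν = o
    · rw [hμ, hν, h0, hoo, mul_one]
    · rw [hμ, hsymm, hmixed ν hν, hne (Ne.symm hν), mul_zero, zero_smul]
  · by_cases hν : ν = o
    · rw [hν, hmixed μ hμ, hne hμ, mul_zero, zero_smul]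
    · have h := hbracket μ o o ν
      rw [hsymm o ν, hmixed ν hν, hoo, hne hμ, hne (Ne.symm hν), h0, mul_zero, zero_mul,
        sub_self] at h
      have h2 : (-Complex.I) •
          (anticommContraction M μ ν - (c * etaM m μ ν) • (1 : A)) = 0 := by
        rw [h]
        module
      exact sub_eq_zero.mp ((smul_eq_zero_iff_right (by simp)).mp h2)
end

section
/- Assume the TKK operator relations (see context). If the quadratic relation (Q1) holds, i.e. (2/ρ)·Σ_{α=1}^{D} L̃_{e_α}² − L̃_e² − (1/2){X̃_e, Ỹ_e} = −a·1 in A, then: (i) Σ_{α=1}^{D} {X̃_{e_α}, L̃_{e_α}} = ρ·{X̃_e, L̃_e}; and (ii) for every u ∈ J, Σ_{α=1}^{D} {X̃_{e_α}, X̃_{e_α u}} = ρ·{X̃_e, X̃_u} (relation (Q3)). -/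
theorem sum_mul_sub_mul_sum {A ι : Type*} [NonUnitalNonAssocRing A] (s : Finset ι) (f : ι → A)
    (x : A) : (∑ i ∈ s, f i) * x - x * ∑ i ∈ s, f i = ∑ i ∈ s, (f i * x - x * f i) := by
  rw [Finset.sum_mul, Finset.mul_sum, Finset.sum_sub_distrib]


/-- Assume the TKK operator relations for ℝ-linear maps `L̃, X̃, Ỹ : J → A` from a
finite-dimensional real unital Jordan algebra `J` to a unital associative ℂ-algebra
`A` (with `S̃_{uv} = [L̃_u, L̃_v] + L̃_{uv}`).  If the quadratic relation (Q1)
`(2/ρ)·Σ_α L̃_{e_α}² − L̃_e² − (1/2){X̃_e, Ỹ_e} = −a·1` holds, then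
(i) `Σ_α {X̃_{e_α}, L̃_{e_α}} = ρ·{X̃_e, L̃_e}`, and
(ii) for every `u ∈ J`, `Σ_α {X̃_{e_α}, X̃_{e_α u}} = ρ·{X̃_e, X̃_u}` (relation (Q3)). -/
theorem stmt6 {J : Type*} [NonUnitalNonAssocCommRing J] [Module ℝ J]
    [SMulCommClass ℝ J J] [IsScalarTower ℝ J J] [FiniteDimensional ℝ J]
    (jordan : ∀ x y : J, x * (x * x * y) = x * x * (x * y))
    (e : J) (he : ∀ x : J, e * x = x)
    {A : Type*} [Ring A] [Algebra ℂ A]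
    (L X Y : J →ₗ[ℝ] A)
    (hXX : ∀ u v, X u * X v = X v * X u)
    (hYY : ∀ u v, Y u * Y v = Y v * Y u)
    (hXY : ∀ u v, X u * Y v - Y v * X u
      = -((2 : ℂ) • (L u * L v - L v * L u + L (u * v))))
    (hLX : ∀ u v, L u * X v - X v * L u = X (u * v))
    (hLY : ∀ u v, L u * Y v - Y v * L u = -(Y (u * v)))
    (hLe : ∀ u, L e * L u = L u * L e)
    (D : ℕ) (b : Fin D → J) (ρ a : ℝ) (hρ : ρ ≠ 0)
    (hQ1 : (2 / (ρ : ℂ)) • ∑ α, L (b α) * L (b α) - L e * L e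
        - (1 / 2 : ℂ) • (X e * Y e + Y e * X e) = -((a : ℂ) • (1 : A))) :
    (∑ α, (X (b α) * L (b α) + L (b α) * X (b α))
        = (ρ : ℂ) • (X e * L e + L e * X e)) ∧
    (∀ u : J, ∑ α, (X (b α) * X (b α * u) + X (b α * u) * X (b α))
        = (ρ : ℂ) • (X e * X u + X u * X e)) := by
  have hρ' : (ρ : ℂ) ≠ 0 := by exact_mod_cast hρ
  have hLXe : ∀ u, L u * X e = X e * L u + X u := fun u => by
    rw [← sub_eq_iff_eq_add', hLX, mul_comm, he]
  have hXYe : Y e * X e = X e * Y e + (2 : ℂ) • L e := by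
    have h := hXY e e
    rw [sub_self, zero_add, he] at h
    rw [← sub_eq_iff_eq_add', ← neg_sub, h, neg_neg]
  have hL2 : (∑ α, L (b α) * L (b α)) * X e - X e * ∑ α, L (b α) * L (b α)
      = ∑ α, (X (b α) * L (b α) + L (b α) * X (b α)) := by
    rw [sum_mul_sub_mul_sum]
    refine Finset.sum_congr rfl fun α _ => ?_
    rw [mul_assoc, hLXe, mul_add, ← mul_assoc, hLXe, add_mul, ← mul_assoc]
    abel
  have hLe2 : L e * L e * X e - X e * (L e * L e) = X e * L e + L e * X e := by
    rw [mul_assoc, hLXe, mul_add, ← mul_assoc, hLXe, add_mul, ← mul_assoc]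
    abel
  have hXYe2 : (X e * Y e + Y e * X e) * X e - X e * (X e * Y e + Y e * X e)
      = (2 : ℂ) • (X e * L e + L e * X e) := by
    have h : (X e * Y e + Y e * X e) * X e - X e * (X e * Y e + Y e * X e)
        = X e * (Y e * X e - X e * Y e) + (Y e * X e - X e * Y e) * X e := by
      noncomm_ring
    rw [h, hXYe, add_sub_cancel_left, mul_smul_comm, smul_mul_assoc, ← smul_add]
  have h1 : ∑ α, (X (b α) * L (b α) + L (b α) * X (b α))
      = (ρ : ℂ) • (X e * L e + L e * X e) := by
    have h := congrArg (fun z => z * X e - X e * z) hQ1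
    have h0 : (2 / (ρ : ℂ)) • ∑ α, (X (b α) * L (b α) + L (b α) * X (b α))
        - (X e * L e + L e * X e) - (1 / 2 : ℂ) • (2 : ℂ) • (X e * L e + L e * X e) = 0 := by
      rw [← hL2, ← hXYe2, ← hLe2]
      simp only [sub_mul, mul_sub, smul_mul_assoc, mul_smul_comm, neg_mul, mul_neg, one_mul,
        mul_one, sub_self] at h
      rw [← h]
      simp only [smul_sub]
      abel
    rw [smul_smul, one_div, inv_mul_cancel₀ two_ne_zero, one_smul, sub_sub, sub_eq_zero,
      ← two_smul ℂ] at h0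
    have h2 := congrArg (fun z => ((ρ : ℂ) / 2) • z) h0
    simp only [smul_smul] at h2
    rwa [div_mul_div_cancel₀ two_ne_zero, div_self hρ', one_smul,
      div_mul_cancel₀ _ two_ne_zero] at h2
  refine ⟨h1, fun u => ?_⟩
  have key : ∀ v, (X v * L v + L v * X v) * X u - X u * (X v * L v + L v * X v)
      = X v * X (v * u) + X (v * u) * X v := fun v => by
    have h : L v * X u = X u * L v + X (v * u) := by
      rw [← sub_eq_iff_eq_add', hLX]
    rw [add_mul, mul_assoc, h, mul_assoc, hXX v u, ← mul_assoc (L v), h, mul_add, ← mul_assoc,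
      hXX v u]
    noncomm_ring
  have h := congrArg (fun z => z * X u - X u * z) h1
  simp only [sum_mul_sub_mul_sum, smul_mul_assoc, mul_smul_comm, ← smul_sub, key, he] at h
  exact h
end

section
/- Assume the TKK operator relations (see context), and assume additionally [S̃_{uv}, S̃_{zw}] = S̃_{{uvz}w} − S̃_{z{vuw}} for all u, v, z, w ∈ J. If the quadratic relation (Q1) holds, i.e. (2/ρ)·Σ_{α=1}^{D} L̃_{e_α}² − L̃_e² − (1/2){X̃_e, Ỹ_e} = −a·1, then for every u ∈ J the relation (Q4) holds: (2/ρ)·Σ_{α=1}^{D} {L̃_{e_α}, L̃_{e_α u² − u(u e_α)}} + (4/ρ)·Σ_{α=1}^{D} [L̃_u, L̃_{e_α}]² + {X̃_u, Ỹ_u} − (1/2){X̃_{u²}, Ỹ_e} − (1/2){X̃_e, Ỹ_{u²}} = 0. -/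
/-- The second derivation identity `[p, [p, q²]] = {q, [p, [p, q]]} + 2 [p, q]²`. -/
lemma commutator_commutator_mul_self {A : Type*} [Ring A] (p q : A) :
    p * (p * (q * q) - q * q * p) - (p * (q * q) - q * q * p) * p
      = (q * (p * (p * q - q * p) - (p * q - q * p) * p)
          + (p * (p * q - q * p) - (p * q - q * p) * p) * q)
        + (2 : ℕ) • ((p * q - q * p) * (p * q - q * p)) := by
  noncomm_ring

/-- If `[p, x₀] = x₁`, `[p, x₁] = x₂`, `[p, y₀] = -y₁` and `[p, y₁] = -y₂`, then
`[p, [p, {x₀, y₀}]] = {x₂, y₀} - 2 {x₁, y₁} + {x₀, y₂}`. -/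
lemma commutator_commutator_anticommutator {A : Type*} [Ring A] {p x₀ x₁ x₂ y₀ y₁ y₂ : A}
    (hx₀ : p * x₀ - x₀ * p = x₁) (hx₁ : p * x₁ - x₁ * p = x₂)
    (hy₀ : p * y₀ - y₀ * p = -y₁) (hy₁ : p * y₁ - y₁ * p = -y₂) :
    p * (p * (x₀ * y₀ + y₀ * x₀) - (x₀ * y₀ + y₀ * x₀) * p)
        - (p * (x₀ * y₀ + y₀ * x₀) - (x₀ * y₀ + y₀ * x₀) * p) * p
      = (x₂ * y₀ + y₀ * x₂) - (2 : ℕ) • (x₁ * y₁ + y₁ * x₁) + (x₀ * y₂ + y₂ * x₀) := by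
  obtain rfl : y₁ = -(p * y₀ - y₀ * p) := by rw [hy₀, neg_neg]
  obtain rfl : y₂ = -(p * -(p * y₀ - y₀ * p) - -(p * y₀ - y₀ * p) * p) := by rw [hy₁, neg_neg]
  subst hx₀ hx₁
  noncomm_ring


/-- Assume the TKK operator relations for ℝ-linear maps `L̃, X̃, Ỹ : J → A`, with
`S̃_{uv} = [L̃_u, L̃_v] + L̃_{uv}`, and assume additionally
`[S̃_{uv}, S̃_{zw}] = S̃_{{uvz}w} − S̃_{z{vuw}}`.  If the quadratic relation (Q1)
holds, then for every `u ∈ J` the relation (Q4) holds: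
`(2/ρ)·Σ_α {L̃_{e_α}, L̃_{e_α u² − u(u e_α)}} + (4/ρ)·Σ_α [L̃_u, L̃_{e_α}]²
 + {X̃_u, Ỹ_u} − (1/2){X̃_{u²}, Ỹ_e} − (1/2){X̃_e, Ỹ_{u²}} = 0`. -/
theorem stmt7 {J : Type*} [NonUnitalNonAssocCommRing J] [Module ℝ J]
    [SMulCommClass ℝ J J] [IsScalarTower ℝ J J] [FiniteDimensional ℝ J]
    (jordan : ∀ x y : J, x * (x * x * y) = x * x * (x * y))
    (e : J) (he : ∀ x : J, e * x = x)
    {A : Type*} [Ring A] [Algebra ℂ A]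
    (L X Y : J →ₗ[ℝ] A)
    (S : J → J → A)
    (hSdef : ∀ u v, S u v = L u * L v - L v * L u + L (u * v))
    (hXX : ∀ u v, X u * X v = X v * X u)
    (hYY : ∀ u v, Y u * Y v = Y v * Y u)
    (hXY : ∀ u v, X u * Y v - Y v * X u = -((2 : ℂ) • S u v))
    (hLX : ∀ u v, L u * X v - X v * L u = X (u * v))
    (hLY : ∀ u v, L u * Y v - Y v * L u = -(Y (u * v)))
    (hLe : ∀ u, L e * L u = L u * L e)
    (hSS : ∀ u v z w, S u v * S z w - S z w * S u v
      = S (u * (v * z) - v * (u * z) + (u * v) * z) w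
        - S z (v * (u * w) - u * (v * w) + (v * u) * w))
    (D : ℕ) (b : Fin D → J) (ρ a : ℝ) (hρ : ρ ≠ 0)
    (hQ1 : (2 / (ρ : ℂ)) • ∑ α, L (b α) * L (b α) - L e * L e
        - (1 / 2 : ℂ) • (X e * Y e + Y e * X e) = -((a : ℂ) • (1 : A))) :
    ∀ u : J,
      (2 / (ρ : ℂ)) • ∑ α, (L (b α) * L (b α * (u * u) - u * (u * b α))
          + L (b α * (u * u) - u * (u * b α)) * L (b α))
        + (4 / (ρ : ℂ)) • ∑ α, (L u * L (b α) - L (b α) * L u)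
            * (L u * L (b α) - L (b α) * L u)
        + (X u * Y u + Y u * X u)
        - (1 / 2 : ℂ) • (X (u * u) * Y e + Y e * X (u * u))
        - (1 / 2 : ℂ) • (X e * Y (u * u) + Y (u * u) * X e) = 0 := by
  intro u
  have hSe : ∀ z, S z e = L z := fun z => by
    rw [hSdef, mul_comm z e, he, hLe, sub_self, zero_add]
  have hLL : ∀ v, L u * (L u * L v - L v * L u) - (L u * L v - L v * L u) * L u
      = L (v * (u * u) - u * (u * v)) := fun v => by
    have h₁ := hSS u v u e
    have h₂ := hSS v u u e
    simp only [hSe, mul_comm _ e, he, hSdef] at h₁ h₂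
    simp only [mul_comm v u, sub_self, zero_add, map_add, map_sub] at h₁ h₂
    rw [map_sub]
    have h : (2 : ℂ) • (L u * (L u * L v - L v * L u) - (L u * L v - L v * L u) * L u)
        = (2 : ℂ) • (L (v * (u * u)) - L (u * (u * v))) := by
      rw [two_smul, two_smul]
      linear_combination (norm := noncomm_ring) h₂ - h₁
    exact smul_right_injective A (two_ne_zero (α := ℂ)) h
  have hsum : L u * (L u * ∑ α, L (b α) * L (b α) - (∑ α, L (b α) * L (b α)) * L u)
        - (L u * ∑ α, L (b α) * L (b α) - (∑ α, L (b α) * L (b α)) * L u) * L u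
      = ∑ α, (L (b α) * L (b α * (u * u) - u * (u * b α))
          + L (b α * (u * u) - u * (u * b α)) * L (b α))
        + (2 : ℂ) • ∑ α, (L u * L (b α) - L (b α) * L u)
            * (L u * L (b α) - L (b α) * L u) := by
    simp only [Finset.mul_sum, Finset.sum_mul, Finset.smul_sum, ← Finset.sum_sub_distrib,
      ← Finset.sum_add_distrib]
    refine Finset.sum_congr rfl fun α _ => ?_
    rw [commutator_commutator_mul_self, hLL, two_smul, two_smul]
  have hE : L u * (L u * (L e * L e) - L e * L e * L u)
      - (L u * (L e * L e) - L e * L e * L u) * L u = 0 := by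
    have h : L u * (L e * L e) - L e * L e * L u = 0 := by
      rw [← mul_assoc, ← hLe, mul_assoc, ← hLe, mul_assoc, sub_self]
    rw [h, mul_zero, zero_mul, sub_zero]
  have hue : u * e = u := by rw [mul_comm, he]
  have hXYe := commutator_commutator_anticommutator (p := L u) (x₀ := X e) (x₁ := X u)
    (x₂ := X (u * u)) (y₀ := Y e) (y₁ := Y u) (y₂ := Y (u * u))
    (by rw [hLX, hue]) (hLX u u) (by rw [hLY, hue]) (hLY u u)
  have hQ := congrArg (fun q => L u * (L u * q - q * L u) - (L u * q - q * L u) * L u) hQ1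
  generalize ∑ α, L (b α) * L (b α) = s at hsum hQ
  generalize L e * L e = t at hE hQ
  generalize X e * Y e + Y e * X e = w at hXYe hQ
  have hsplit : (2 / (ρ : ℂ)) • (L u * (L u * s - s * L u) - (L u * s - s * L u) * L u)
      - (L u * (L u * t - t * L u) - (L u * t - t * L u) * L u)
      - (1 / 2 : ℂ) • (L u * (L u * w - w * L u) - (L u * w - w * L u) * L u) = 0 := by
    simp only [mul_sub, sub_mul, mul_neg, neg_mul, mul_smul_comm, smul_mul_assoc, mul_one,
      one_mul, smul_sub] at hQ ⊢
    rw [← sub_eq_zero] at hQ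
    rw [← hQ]
    abel
  rw [hsum, hE, hXYe] at hsplit
  rw [← hsplit]
  module
end

section
/- Assume the TKK operator relations (see context), and assume additionally that J carries an inner product ⟨·,·⟩ satisfying ⟨uv, w⟩ = ⟨v, uw⟩ for all u, v, w ∈ J, and that e_1, …, e_D is an orthonormal basis of J. Set Q₁' := Σ_{α=1}^{D} {X̃_{e_α}, Ỹ_{e_α}} − 2ρ·(L̃_e² + a·1) ∈ A. Then Q₁' commutes with L̃_u for every u ∈ J, i.e. [Q₁', L̃_u] = 0. -/
/-- A family that is orthonormal and spanning for a form `B` expands every vector along itself. -/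
theorem eq_sum_smul_of_orthonormal_span {V ι : Type*} [AddCommGroup V] [Module ℝ V]
    [Fintype ι] [DecidableEq ι] (B : V → V →ₗ[ℝ] ℝ) (b : ι → V)
    (horth : ∀ i j, B (b j) (b i) = if i = j then 1 else 0)
    (hspan : Submodule.span ℝ (Set.range b) = ⊤) (x : V) :
    x = ∑ i, B (b i) x • b i := by
  obtain ⟨c, rfl⟩ := (Submodule.mem_span_range_iff_exists_fun ℝ).1
    (hspan ▸ Submodule.mem_top : x ∈ Submodule.span ℝ (Set.range b))
  simp [horth]

/-- An operator with symmetric matrix `m` in the family `b` can be moved from one factor to the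
other in `∑ i, X (b i) * Y (b i)`. -/
theorem sum_map_mul_eq_sum_mul_map {V A ι : Type*} [AddCommGroup V] [Module ℝ V]
    [Ring A] [Algebra ℝ A] [Fintype ι] (X Y : V →ₗ[ℝ] A) (T : V → V) (b : ι → V)
    (m : ι → ι → ℝ) (hm : ∀ i j, m i j = m j i) (hT : ∀ i, T (b i) = ∑ j, m i j • b j) :
    ∑ i, X (T (b i)) * Y (b i) = ∑ i, X (b i) * Y (T (b i)) := by
  simp only [hT, map_sum, map_smul, Finset.sum_mul, Finset.mul_sum, smul_mul_assoc,
    mul_smul_comm]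
  rw [Finset.sum_comm]
  simp only [hm]


/-- Assume the TKK operator relations for ℝ-linear maps `L̃, X̃, Ỹ : J → A`, and assume
`J` carries an inner product `⟨·,·⟩` (a symmetric positive-definite bilinear form)
satisfying the associativity `⟨uv, w⟩ = ⟨v, uw⟩`, for which `e_1, …, e_D` is an
orthonormal basis.  Set `Q₁' := Σ_α {X̃_{e_α}, Ỹ_{e_α}} − 2ρ·(L̃_e² + a·1)`.
Then `[Q₁', L̃_u] = 0` for every `u ∈ J`. -/
theorem stmt9 {J : Type*} [NonUnitalNonAssocCommRing J] [Module ℝ J]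
    [SMulCommClass ℝ J J] [IsScalarTower ℝ J J] [FiniteDimensional ℝ J]
    (jordan : ∀ x y : J, x * (x * x * y) = x * x * (x * y))
    (e : J) (he : ∀ x : J, e * x = x)
    {A : Type*} [Ring A] [Algebra ℂ A]
    (L X Y : J →ₗ[ℝ] A)
    (hXX : ∀ u v, X u * X v = X v * X u)
    (hYY : ∀ u v, Y u * Y v = Y v * Y u)
    (hXY : ∀ u v, X u * Y v - Y v * X u
      = -((2 : ℂ) • (L u * L v - L v * L u + L (u * v))))
    (hLX : ∀ u v, L u * X v - X v * L u = X (u * v))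
    (hLY : ∀ u v, L u * Y v - Y v * L u = -(Y (u * v)))
    (hLe : ∀ u, L e * L u = L u * L e)
    (ρ a : ℝ) (hρ : ρ ≠ 0)
    -- the inner product on `J`
    (inn : J → J → ℝ)
    (hsymm : ∀ u v, inn u v = inn v u)
    (hbil₁ : ∀ (r : ℝ) (u u' v : J), inn (r • u + u') v = r * inn u v + inn u' v)
    (hpos : ∀ u : J, u ≠ 0 → 0 < inn u u)
    (hassoc : ∀ u v w : J, inn (u * v) w = inn v (u * w))
    -- `e_1, …, e_D` is an orthonormal basis
    (D : ℕ) (b : Fin D → J)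
    (horth : ∀ α β, inn (b α) (b β) = if α = β then 1 else 0)
    (hspan : Submodule.span ℝ (Set.range b) = ⊤)
    (Q : A)
    (hQ : Q = ∑ α, (X (b α) * Y (b α) + Y (b α) * X (b α))
        - (2 * (ρ : ℂ)) • (L e * L e + (a : ℂ) • (1 : A))) :
    ∀ u : J, Q * L u - L u * Q = 0 := by
  intro u
  have hzero (v : J) : inn 0 v = 0 := by simpa using hbil₁ 1 0 0 v
  let B (v : J) : J →ₗ[ℝ] ℝ := IsLinearMap.mk' (fun x => inn x v)
    ⟨fun x y => by simpa using hbil₁ 1 x y v, fun r x => by simpa [hzero] using hbil₁ r x 0 v⟩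
  have hexp (i : Fin D) : u * b i = ∑ j, inn (u * b i) (b j) • b j :=
    eq_sum_smul_of_orthonormal_span B b horth hspan (u * b i)
  have hm (i j : Fin D) : inn (u * b i) (b j) = inn (u * b j) (b i) := by
    rw [hassoc, hsymm]
  have hXYmove := sum_map_mul_eq_sum_mul_map X Y (u * ·) b _ hm hexp
  have hYXmove := sum_map_mul_eq_sum_mul_map Y X (u * ·) b _ hm hexp
  have hsum : (∑ i, (X (b i) * Y (b i) + Y (b i) * X (b i))) * L u
      - L u * ∑ i, (X (b i) * Y (b i) + Y (b i) * X (b i)) = 0 := by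
    have hterm (i : Fin D) : (X (b i) * Y (b i) + Y (b i) * X (b i)) * L u
        - L u * (X (b i) * Y (b i) + Y (b i) * X (b i))
        = (X (b i) * Y (u * b i) - X (u * b i) * Y (b i))
          + (Y (u * b i) * X (b i) - Y (b i) * X (u * b i)) := by
      rw [← hLX u (b i), ← neg_neg (Y (u * b i)), ← hLY u (b i)]
      noncomm_ring
    rw [Finset.sum_mul, Finset.mul_sum, ← Finset.sum_sub_distrib]
    simp only [hterm, Finset.sum_add_distrib, Finset.sum_sub_distrib]
    rw [hXYmove, hYXmove, sub_self, sub_self, add_zero]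
  have hsq : Commute (L e * L e + (a : ℂ) • (1 : A)) (L u) :=
    (Commute.mul_left (hLe u) (hLe u)).add_left ((Commute.one_left _).smul_left _)
  rw [hQ, sub_mul, mul_sub, sub_sub_sub_comm, hsum, (hsq.smul_left _).eq, sub_self, sub_zero]
end

section
/- Assume the TKK operator relations (see context) and set Q₁' := Σ_{α=1}^{D} {X̃_{e_α}, Ỹ_{e_α}} − 2ρ·(L̃_e² + a·1). Then for all u, v, w ∈ J: [[Q₁', X̃_u], X̃_v] = 4·Σ_{α=1}^{D} X̃_{e_α} X̃_{{u e_α v}} − 4ρ·X̃_u X̃_v, and moreover [[[Q₁', X̃_u], X̃_v], X̃_w] = 0. -/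
section

attribute [local instance] LieRing.ofAssociativeRing

/-- If `p` commutes with `x`, `z` and `t`, where `⁅⁅y, x⁆, z⁆ = t`, then the double commutator of the
anticommutator `p * y + y * p` with `x` and `z` is `2 * (p * t)`. -/
theorem lie_lie_anticommutator {A : Type*} [Ring A] {p y x z s t : A}
    (hpx : p * x = x * p) (hpz : p * z = z * p) (hpt : p * t = t * p)
    (hs : ⁅y, x⁆ = s) (ht : ⁅s, z⁆ = t) :
    ⁅⁅p * y + y * p, x⁆, z⁆ = p * t + p * t := by
  have h1 : ⁅p * y + y * p, x⁆ = p * s + s * p := by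
    rw [← hs]
    simp only [LieRing.of_associative_ring_bracket, mul_sub, sub_mul, add_mul, mul_add,
      mul_assoc, hpx]
    simp only [← mul_assoc, hpx]
    abel
  have h2 : ⁅p * s + s * p, z⁆ = p * t + t * p := by
    rw [← ht]
    simp only [LieRing.of_associative_ring_bracket, mul_sub, sub_mul, add_mul, mul_add,
      mul_assoc, hpz]
    simp only [← mul_assoc, hpz]
    abel
  rw [h1, h2, hpt]

/-- If `⁅d, x⁆ = x` and `⁅d, z⁆ = z` for commuting `x`, `z`, then `⁅⁅d * d, x⁆, z⁆ = 2 * (x * z)`. -/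
theorem lie_lie_mul_self {A : Type*} [Ring A] {d x z : A}
    (hxz : x * z = z * x) (hx : ⁅d, x⁆ = x) (hz : ⁅d, z⁆ = z) :
    ⁅⁅d * d, x⁆, z⁆ = x * z + x * z := by
  have h1 : ⁅d * d, x⁆ = d * x + x * d := by
    have : ⁅d * d, x⁆ = d * ⁅d, x⁆ + ⁅d, x⁆ * d := by
      simp only [LieRing.of_associative_ring_bracket]; noncomm_ring
    rw [this, hx]
  have h2 : ⁅d * x + x * d, z⁆ = ⁅d, z⁆ * x + x * ⁅d, z⁆ := by
    simp only [LieRing.of_associative_ring_bracket, mul_sub, sub_mul, add_mul, mul_add,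
      mul_assoc, hxz]
    simp only [← mul_assoc, hxz]
    abel
  rw [h1, h2, hz, hxz]

end

/-- Assume the TKK operator relations and set
`Q₁' := Σ_α {X̃_{e_α}, Ỹ_{e_α}} − 2ρ·(L̃_e² + a·1)`.  Then for all `u, v, w ∈ J`:
`[[Q₁', X̃_u], X̃_v] = 4·Σ_α X̃_{e_α} X̃_{{u e_α v}} − 4ρ·X̃_u X̃_v`, and moreover
`[[[Q₁', X̃_u], X̃_v], X̃_w] = 0`. -/
theorem stmt10 {J : Type*} [NonUnitalNonAssocCommRing J] [Module ℝ J]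
    [SMulCommClass ℝ J J] [IsScalarTower ℝ J J] [FiniteDimensional ℝ J]
    (jordan : ∀ x y : J, x * (x * x * y) = x * x * (x * y))
    (e : J) (he : ∀ x : J, e * x = x)
    {A : Type*} [Ring A] [Algebra ℂ A]
    (L X Y : J →ₗ[ℝ] A)
    (hXX : ∀ u v, X u * X v = X v * X u)
    (hYY : ∀ u v, Y u * Y v = Y v * Y u)
    (hXY : ∀ u v, X u * Y v - Y v * X u
      = -((2 : ℂ) • (L u * L v - L v * L u + L (u * v))))
    (hLX : ∀ u v, L u * X v - X v * L u = X (u * v))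
    (hLY : ∀ u v, L u * Y v - Y v * L u = -(Y (u * v)))
    (hLe : ∀ u, L e * L u = L u * L e)
    (D : ℕ) (b : Fin D → J) (ρ a : ℝ) (hρ : ρ ≠ 0)
    (Q : A)
    (hQ : Q = ∑ α, (X (b α) * Y (b α) + Y (b α) * X (b α))
        - (2 * (ρ : ℂ)) • (L e * L e + (a : ℂ) • (1 : A))) :
    ∀ u v w : J,
      ((Q * X u - X u * Q) * X v - X v * (Q * X u - X u * Q)
        = (4 : ℂ) • ∑ α, X (b α) * X (u * (b α * v) - b α * (u * v) + (u * b α) * v)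
          - (4 * (ρ : ℂ)) • (X u * X v)) ∧
      (((Q * X u - X u * Q) * X v - X v * (Q * X u - X u * Q)) * X w
        - X w * ((Q * X u - X u * Q) * X v - X v * (Q * X u - X u * Q)) = 0) := by
  letI := LieRing.ofAssociativeRing (A := A)
  intro u v w
  have key : ⁅⁅Q, X u⁆, X v⁆
      = (4 : ℂ) • ∑ α, X (b α) * X (u * (b α * v) - b α * (u * v) + (u * b α) * v)
          - (4 * (ρ : ℂ)) • (X u * X v) := by
    have hterm : ∀ c : J, ⁅⁅X c * Y c + Y c * X c, X u⁆, X v⁆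
        = (4 : ℂ) • (X c * X (u * (c * v) - c * (u * v) + (u * c) * v)) := by
      intro c
      have hL : ∀ x y : J, ⁅L x, X y⁆ = X (x * y) := hLX
      have hS : ⁅⁅Y c, X u⁆, X v⁆
          = (2 : ℂ) • X (u * (c * v) - c * (u * v) + (u * c) * v) := by
        have h : ⁅Y c, X u⁆ = (2 : ℂ) • (⁅L u, L c⁆ + L (u * c)) := by
          rw [← lie_skew, LieRing.of_associative_ring_bracket, hXY, neg_neg,
            LieRing.of_associative_ring_bracket]
        rw [h, smul_lie, add_lie, lie_lie, hL, hL, hL, hL, hL, map_add, map_sub]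
      rw [lie_lie_anticommutator (hXX c u) (hXX c v)
        (by rw [mul_smul_comm, smul_mul_assoc, hXX]) rfl hS, mul_smul_comm, ← add_smul]
      norm_num
    have hE : ⁅⁅L e * L e, X u⁆, X v⁆ = (2 : ℂ) • (X u * X v) := by
      rw [two_smul]
      refine lie_lie_mul_self (hXX u v) ?_ ?_ <;>
        rw [LieRing.of_associative_ring_bracket, hLX, he]
    have h1 : ⁅(1 : A), X u⁆ = 0 := by simp [LieRing.of_associative_ring_bracket]
    rw [hQ]
    simp only [sub_lie, sum_lie, smul_lie, add_lie (L e * L e), h1, hterm, hE,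
      smul_zero, add_zero, Finset.smul_sum, smul_smul]
    congr 2
    ring
  simp only [LieRing.of_associative_ring_bracket] at key
  refine ⟨key, ?_⟩
  rw [key, sub_eq_zero]
  change Commute _ _
  have hc : ∀ x y : J, Commute (X x) (X y) := hXX
  refine Commute.sub_left (Commute.smul_left (Commute.sum_left _ _ _ fun α _ => ?_) _)
    (Commute.smul_left ?_ _) <;> exact (hc _ _).mul_left (hc _ _)
end

section
/- Assume the TKK operator relations (see context) and set Q₁' := Σ_{α=1}^{D} {X̃_{e_α}, Ỹ_{e_α}} − 2ρ·(L̃_e² + a·1). Then for every u ∈ J: [Q₁', X̃_u] = 2·Σ_{α=1}^{D} {X̃_{e_α}, S̃_{u e_α}} − 2ρ·{L̃_e, X̃_u}, and [Q₁', Ỹ_u] = −2·Σ_{α=1}^{D} {Ỹ_{e_α}, S̃_{e_α u}} + 2ρ·{L̃_e, Ỹ_u}. -/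
/-- If `p` commutes with `z`, then `[{p, q}, z] = {p, [q, z]}`. -/
theorem anticommutator_commutator_of_commute {R : Type*} [Ring R] {p z : R} (q : R)
    (h : p * z = z * p) :
    (p * q + q * p) * z - z * (p * q + q * p) = p * (q * z - z * q) + (q * z - z * q) * p := by
  have h₁ : q * p * z = q * z * p := by rw [mul_assoc, h, mul_assoc]
  have h₂ : z * (p * q) = p * z * q := by rw [← mul_assoc, h]
  simp only [mul_add, add_mul, mul_sub, sub_mul, h₁, h₂, ← mul_assoc, h]
  abel

/-- `[l², z] = {l, [l, z]}`. -/
theorem mul_self_commutator {R : Type*} [Ring R] (l z : R) :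
    l * l * z - z * (l * l) = l * (l * z - z * l) + (l * z - z * l) * l := by
  noncomm_ring

/-- The commutator of `∑ i, {p i, q i} - c • (l² + t • 1)` with an element `z` commuting with
every `p i`. -/
theorem sum_anticommutator_sub_smul_commutator {K R ι : Type*} [CommRing K] [Ring R] [Algebra K R]
    [Fintype ι] (p q : ι → R) (l z : R) (c t : K) (h : ∀ i, p i * z = z * p i) :
    (∑ i, (p i * q i + q i * p i) - c • (l * l + t • (1 : R))) * z
        - z * (∑ i, (p i * q i + q i * p i) - c • (l * l + t • (1 : R)))
      = ∑ i, (p i * (q i * z - z * q i) + (q i * z - z * q i) * p i)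
        - c • (l * (l * z - z * l) + (l * z - z * l) * l) := by
  simp only [← anticommutator_commutator_of_commute _ (h _), ← mul_self_commutator,
    Finset.sum_sub_distrib, ← Finset.sum_mul, ← Finset.mul_sum]
  simp only [sub_mul, mul_sub, add_mul, mul_add, smul_mul_assoc, mul_smul_comm, one_mul, mul_one,
    smul_add, smul_sub]
  abel


/-- Assume the TKK operator relations and set
`Q₁' := Σ_α {X̃_{e_α}, Ỹ_{e_α}} − 2ρ·(L̃_e² + a·1)`.  Then for every `u ∈ J`:
`[Q₁', X̃_u] = 2·Σ_α {X̃_{e_α}, S̃_{u e_α}} − 2ρ·{L̃_e, X̃_u}` and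
`[Q₁', Ỹ_u] = −2·Σ_α {Ỹ_{e_α}, S̃_{e_α u}} + 2ρ·{L̃_e, Ỹ_u}`. -/
theorem stmt11 {J : Type*} [NonUnitalNonAssocCommRing J] [Module ℝ J]
    [SMulCommClass ℝ J J] [IsScalarTower ℝ J J] [FiniteDimensional ℝ J]
    (jordan : ∀ x y : J, x * (x * x * y) = x * x * (x * y))
    (e : J) (he : ∀ x : J, e * x = x)
    {A : Type*} [Ring A] [Algebra ℂ A]
    (L X Y : J →ₗ[ℝ] A)
    (S : J → J → A)
    (hSdef : ∀ u v, S u v = L u * L v - L v * L u + L (u * v))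
    (hXX : ∀ u v, X u * X v = X v * X u)
    (hYY : ∀ u v, Y u * Y v = Y v * Y u)
    (hXY : ∀ u v, X u * Y v - Y v * X u = -((2 : ℂ) • S u v))
    (hLX : ∀ u v, L u * X v - X v * L u = X (u * v))
    (hLY : ∀ u v, L u * Y v - Y v * L u = -(Y (u * v)))
    (hLe : ∀ u, L e * L u = L u * L e)
    (D : ℕ) (b : Fin D → J) (ρ a : ℝ) (hρ : ρ ≠ 0)
    (Q : A)
    (hQ : Q = ∑ α, (X (b α) * Y (b α) + Y (b α) * X (b α))
        - (2 * (ρ : ℂ)) • (L e * L e + (a : ℂ) • (1 : A))) :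
    ∀ u : J,
      (Q * X u - X u * Q
        = (2 : ℂ) • ∑ α, (X (b α) * S u (b α) + S u (b α) * X (b α))
          - (2 * (ρ : ℂ)) • (L e * X u + X u * L e)) ∧
      (Q * Y u - Y u * Q
        = -((2 : ℂ) • ∑ α, (Y (b α) * S (b α) u + S (b α) u * Y (b α)))
          + (2 * (ρ : ℂ)) • (L e * Y u + Y u * L e)) := by
  intro u
  subst hQ
  constructor
  · have hYX (v : J) : Y v * X u - X u * Y v = (2 : ℂ) • S u v := by
      rw [← neg_sub, hXY, neg_neg]
    rw [sum_anticommutator_sub_smul_commutator _ _ _ _ _ _ fun α => hXX (b α) u]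
    simp only [hYX, hLX, he, mul_smul_comm, smul_mul_assoc, ← smul_add, ← Finset.smul_sum]
  · simp only [add_comm (X _ * Y _)]
    rw [sum_anticommutator_sub_smul_commutator _ _ _ _ _ _ fun α => hYY (b α) u]
    simp only [hXY, hLY, he, mul_neg, neg_mul, mul_smul_comm, smul_mul_assoc, ← neg_add,
      ← smul_add, Finset.sum_neg_distrib, ← Finset.smul_sum, smul_neg, sub_neg_eq_add]
end

section
/- Assume the TKK operator relations (see context). If the quadratic relation (Q1) holds, i.e. (2/ρ)·Σ_{α=1}^{D} L̃_{e_α}² − L̃_e² − (1/2){X̃_e, Ỹ_e} = −a·1, then for every u ∈ J: (2/ρ)·Σ_{α=1}^{D} {L̃_{e_α}, [L̃_{e_α}, L̃_u]} + (1/2)·({X̃_u, Ỹ_e} − {X̃_e, Ỹ_u}) = 0. -/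
/-- Assume the TKK operator relations.  If the quadratic relation (Q1)
`(2/ρ)·Σ_α L̃_{e_α}² − L̃_e² − (1/2){X̃_e, Ỹ_e} = −a·1` holds, then for every `u ∈ J`:
`(2/ρ)·Σ_α {L̃_{e_α}, [L̃_{e_α}, L̃_u]} + (1/2)({X̃_u, Ỹ_e} − {X̃_e, Ỹ_u}) = 0`. -/
theorem stmt12 {J : Type*} [NonUnitalNonAssocCommRing J] [Module ℝ J]
    [SMulCommClass ℝ J J] [IsScalarTower ℝ J J] [FiniteDimensional ℝ J]
    (jordan : ∀ x y : J, x * (x * x * y) = x * x * (x * y))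
    (e : J) (he : ∀ x : J, e * x = x)
    {A : Type*} [Ring A] [Algebra ℂ A]
    (L X Y : J →ₗ[ℝ] A)
    (hXX : ∀ u v, X u * X v = X v * X u)
    (hYY : ∀ u v, Y u * Y v = Y v * Y u)
    (hXY : ∀ u v, X u * Y v - Y v * X u
      = -((2 : ℂ) • (L u * L v - L v * L u + L (u * v))))
    (hLX : ∀ u v, L u * X v - X v * L u = X (u * v))
    (hLY : ∀ u v, L u * Y v - Y v * L u = -(Y (u * v)))
    (hLe : ∀ u, L e * L u = L u * L e)
    (D : ℕ) (b : Fin D → J) (ρ a : ℝ) (hρ : ρ ≠ 0)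
    (hQ1 : (2 / (ρ : ℂ)) • ∑ α, L (b α) * L (b α) - L e * L e
        - (1 / 2 : ℂ) • (X e * Y e + Y e * X e) = -((a : ℂ) • (1 : A))) :
    ∀ u : J,
      (2 / (ρ : ℂ)) • ∑ α, (L (b α) * (L (b α) * L u - L u * L (b α))
          + (L (b α) * L u - L u * L (b α)) * L (b α))
        + (1 / 2 : ℂ) • ((X u * Y e + Y e * X u) - (X e * Y u + Y u * X e)) = 0 := by
  intro u
  have hX : L u * X e - X e * L u = X u := by rw [hLX, mul_comm, he]
  have hY : L u * Y e - Y e * L u = -Y u := by rw [hLY, mul_comm, he]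
  have hsum : ∑ α, (L (b α) * (L (b α) * L u - L u * L (b α))
      + (L (b α) * L u - L u * L (b α)) * L (b α))
      = (∑ α, L (b α) * L (b α)) * L u - L u * ∑ α, L (b α) * L (b α) := by
    rw [Finset.sum_mul, Finset.mul_sum, ← Finset.sum_sub_distrib]
    exact Finset.sum_congr rfl fun α _ => by noncomm_ring
  have hXY' : (X u * Y e + Y e * X u) - (X e * Y u + Y u * X e)
      = L u * (X e * Y e + Y e * X e) - (X e * Y e + Y e * X e) * L u := by
    rw [← neg_neg (Y u), ← hY, ← hX]
    noncomm_ring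
  have hLL : L e * L e * L u = L u * (L e * L e) := by
    rw [mul_assoc, hLe u, ← mul_assoc, hLe u, mul_assoc]
  have hcomm := congrArg (fun t => t * L u - L u * t) hQ1
  simp only [sub_mul, mul_sub, neg_mul, mul_neg, smul_mul_assoc, mul_smul_comm, one_mul, mul_one,
    sub_self, hLL] at hcomm
  rw [hsum, hXY', smul_sub, smul_sub, ← hcomm]
  abel
end

section
/- Let n ≥ 3 and let λ_1, …, λ_n be real numbers with λ_n ≤ λ_{n−1} ≤ … ≤ λ_1 ≤ 0, not all zero. Suppose: (i) Σ_{j=2}^{n} λ_j + 2λ_1·(Σ_{j=2}^{n} λ_j) = 0; (ii) for every i with 2 ≤ i ≤ n−1, Σ_{j=i+1}^{n} λ_j + (i−1)λ_i + 2λ_i·(Σ_{p=1, p≠i}^{n} λ_p) = 0; (iii) (n−1)λ_n + 2λ_n·(Σ_{j=1}^{n−1} λ_j) = 0; (iv) (2λ_1 + 2λ_n + 1)·(Σ_{i=1}^{n} λ_i) + (n+3)λ_n − 3λ_1 = 0. Then λ_1 = λ_2 = … = λ_{n−1} = −1/2, and either λ_n = −1/2 or λ_n = −3/2. -/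
/-- Determination of the highest weight in the case `J = H_n(ℝ)`, `co(J) = sp(n, ℝ)`:
if `λ_n ≤ … ≤ λ_1 ≤ 0` are not all zero and satisfy the relations (i)–(iv) coming from
the quadratic relations (Q3) and (Q4), then `λ_1 = … = λ_{n−1} = −1/2` and
`λ_n ∈ {−1/2, −3/2}`. -/
theorem stmt13 (n : ℕ) (hn : 3 ≤ n) (lam : ℕ → ℝ)
    (hmono : ∀ i j, 1 ≤ i → i ≤ j → j ≤ n → lam j ≤ lam i)
    (hneg : lam 1 ≤ 0)
    (hnz : ∃ i ∈ Finset.Icc 1 n, lam i ≠ 0)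
    (h1 : (∑ j ∈ Finset.Icc 2 n, lam j)
        + 2 * lam 1 * (∑ j ∈ Finset.Icc 2 n, lam j) = 0)
    (h2 : ∀ i, 2 ≤ i → i ≤ n - 1 →
      (∑ j ∈ Finset.Icc (i + 1) n, lam j) + ((i : ℝ) - 1) * lam i
        + 2 * lam i * (∑ p ∈ (Finset.Icc 1 n).erase i, lam p) = 0)
    (h3 : ((n : ℝ) - 1) * lam n
        + 2 * lam n * (∑ j ∈ Finset.Icc 1 (n - 1), lam j) = 0)
    (h4 : (2 * lam 1 + 2 * lam n + 1) * (∑ i ∈ Finset.Icc 1 n, lam i)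
        + ((n : ℝ) + 3) * lam n - 3 * lam 1 = 0) :
    (∀ i, 1 ≤ i → i ≤ n - 1 → lam i = -(1 / 2)) ∧
      (lam n = -(1 / 2) ∨ lam n = -(3 / 2)) := by
  have hnp : ∀ i ∈ Finset.Icc 1 n, lam i ≤ 0 := fun i hi =>
    (hmono 1 i le_rfl (Finset.mem_Icc.1 hi).1 (Finset.mem_Icc.1 hi).2).trans hneg
  have htail : ∑ j ∈ Finset.Icc 2 n, lam j ≤ lam n := by
    rw [← Finset.sum_erase_add _ _ (Finset.mem_Icc.2 ⟨by omega, le_rfl⟩ : n ∈ Finset.Icc 2 n)]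
    refine add_le_of_nonpos_left (Finset.sum_nonpos fun i hi => hnp i ?_)
    have := Finset.mem_Icc.1 (Finset.mem_of_mem_erase hi)
    exact Finset.mem_Icc.2 ⟨by omega, this.2⟩
  have hn0 : lam n < 0 := by
    obtain ⟨i, hi, hi0⟩ := hnz
    have hin := Finset.mem_Icc.1 hi
    exact (hmono i n hin.1 hin.2 le_rfl).trans_lt (lt_of_le_of_ne (hnp i hi) hi0)
  have hl1 : lam 1 = -(1 / 2) := by
    have h : (1 + 2 * lam 1) * ∑ j ∈ Finset.Icc 2 n, lam j = 0 := by linarith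
    rcases mul_eq_zero.1 h with h | h <;> linarith
  have hsum : ∑ j ∈ Finset.Icc 1 (n - 1), lam j = -(((n : ℝ) - 1) / 2) := by
    have h : lam n * (((n : ℝ) - 1) + 2 * ∑ j ∈ Finset.Icc 1 (n - 1), lam j) = 0 := by
      linarith
    rcases mul_eq_zero.1 h with h | h <;> linarith
  have hle : ∀ i ∈ Finset.Icc 1 (n - 1), lam i ≤ -(1 / 2) := fun i hi => by
    have hin := Finset.mem_Icc.1 hi
    exact (hmono 1 i le_rfl hin.1 (by omega)).trans_eq hl1
  have hconst : ∑ _j ∈ Finset.Icc 1 (n - 1), (-(1 / 2) : ℝ) = -(((n : ℝ) - 1) / 2) := by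
    rw [Finset.sum_const, Nat.card_Icc, nsmul_eq_mul, Nat.add_sub_cancel,
      Nat.cast_sub (by omega : 1 ≤ n)]
    push_cast
    ring
  have heq := (Finset.sum_eq_sum_iff_of_le hle).1 (hsum.trans hconst.symm)
  refine ⟨fun i hi hin => heq i (Finset.mem_Icc.2 ⟨hi, hin⟩), ?_⟩
  have hS : ∑ i ∈ Finset.Icc 1 n, lam i = -(((n : ℝ) - 1) / 2) + lam n := by
    obtain ⟨m, rfl⟩ : ∃ m, n = m + 1 := ⟨n - 1, by omega⟩
    rw [Finset.sum_Icc_succ_top (by omega), ← hsum, Nat.add_sub_cancel]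
  rw [hS, hl1] at h4
  have h : (lam n + 1 / 2) * (lam n + 3 / 2) = 0 := by linarith
  rcases mul_eq_zero.1 h with h | h
  · left; linarith
  · right; linarith
end

section
/- Let n ≥ 3 and let λ_1, …, λ_{2n} be real numbers, not all zero, such that: (i) λ_n ≤ λ_{n−1} ≤ … ≤ λ_1 ≤ λ_{2n} ≤ λ_{2n−1} ≤ … ≤ λ_{n+1}; (ii) Σ_{i=1}^{2n} λ_i = 0; (iii) λ_i − λ_{n+i} is an integer for every 1 ≤ i ≤ n; (iv) (λ_i − λ_{n+i})(λ_j − λ_{n+j}) = −(λ_j − λ_{n+i}) for all 1 ≤ i < j ≤ n. Then there exists a nonnegative integer k such that either: λ_i = −(n+k)/(2n) for all 1 ≤ i ≤ n, λ_{n+1} = (n−k)/(2n) + k, and λ_{n+j} = (n−k)/(2n) for all 2 ≤ j ≤ n; or: λ_i = −(n−k)/(2n) for all 1 ≤ i ≤ n−1, λ_n = −(n−k)/(2n) − k, and λ_{n+j} = (n+k)/(2n) for all 1 ≤ j ≤ n. -/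
theorem sum_Icc_one_two_mul (f : ℕ → ℝ) (n : ℕ) :
    ∑ i ∈ Finset.Icc 1 (2 * n), f i = ∑ i ∈ Finset.range n, (f (i + 1) + f (n + (i + 1))) := by
  rw [Finset.sum_add_distrib, ← Finset.Ico_add_one_right_eq_Icc, Finset.sum_Ico_eq_sum_range,
    Nat.add_sub_cancel, two_mul, Finset.sum_range_add]
  congr 1 <;> refine Finset.sum_congr rfl fun i _ => congrArg f ?_ <;> omega

theorem eq_one_or_eq_one_of_mul_sub_one {x y z : ℤ} (hx : 1 ≤ x) (hz : 1 ≤ z)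
    (hle : (x - 1) * (z - 1) ≤ 1) (hy : y * (x + z - 1) = x * z) : x = 1 ∨ z = 1 := by
  by_contra! h
  have hx2 : 2 ≤ x := by omega
  have hz2 : 2 ≤ z := by omega
  have hx' : x = 2 := by nlinarith
  have hz' : z = 2 := by nlinarith
  subst hx' hz'
  omega

/-- Determination of the highest weight in the case `J = H_n(ℂ)`, `co(J) = su(n, n)`:
if `λ_1, …, λ_{2n}` (not all zero) satisfy the unitarity chain
`λ_n ≤ … ≤ λ_1 ≤ λ_{2n} ≤ … ≤ λ_{n+1}`, the A-type condition `Σ λ_i = 0`,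
integrality of `λ_i − λ_{n+i}`, and the quadratic relation
`(λ_i − λ_{n+i})(λ_j − λ_{n+j}) = −(λ_j − λ_{n+i})`, then `λ` has one of the
two displayed forms for some nonnegative integer `k`. -/
theorem stmt14 (n : ℕ) (hn : 3 ≤ n) (lam : ℕ → ℝ)
    (hnz : ∃ i ∈ Finset.Icc 1 (2 * n), lam i ≠ 0)
    (hmono1 : ∀ i j, 1 ≤ i → i ≤ j → j ≤ n → lam j ≤ lam i)
    (hmono2 : lam 1 ≤ lam (2 * n))
    (hmono3 : ∀ i j, n + 1 ≤ i → i ≤ j → j ≤ 2 * n → lam j ≤ lam i)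
    (hsum : ∑ i ∈ Finset.Icc 1 (2 * n), lam i = 0)
    (hint : ∀ i, 1 ≤ i → i ≤ n → ∃ z : ℤ, lam i - lam (n + i) = z)
    (hrel : ∀ i j, 1 ≤ i → i < j → j ≤ n →
      (lam i - lam (n + i)) * (lam j - lam (n + j)) = -(lam j - lam (n + i))) :
    ∃ k : ℕ,
      ((∀ i, 1 ≤ i → i ≤ n → lam i = -(((n : ℝ) + k) / (2 * n))) ∧
        lam (n + 1) = ((n : ℝ) - k) / (2 * n) + k ∧
        (∀ j, 2 ≤ j → j ≤ n → lam (n + j) = ((n : ℝ) - k) / (2 * n))) ∨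
      ((∀ i, 1 ≤ i → i ≤ n - 1 → lam i = -(((n : ℝ) - k) / (2 * n))) ∧
        lam n = -(((n : ℝ) - k) / (2 * n)) - k ∧
        (∀ j, 1 ≤ j → j ≤ n → lam (n + j) = ((n : ℝ) + k) / (2 * n))) := by
  have hn1 : (n : ℝ) ≠ 0 := by positivity
  have hrel' : ∀ i j, 1 ≤ i → i < j → j ≤ n →
      (lam (n + i) - lam i) * (lam (n + j) - lam j) = lam (n + i) - lam j := fun i j h1 h2 h3 => by
    linear_combination hrel i j h1 h2 h3
  have hnonconst : ¬ ∃ c, ∀ i, 1 ≤ i → i ≤ n → lam i = c ∧ lam (n + i) = c := by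
    rintro ⟨c, hc⟩
    have hall : ∀ i ∈ Finset.Icc 1 (2 * n), lam i = c := by
      intro i hi
      rw [Finset.mem_Icc] at hi
      rcases le_or_gt i n with h | h
      · exact (hc i hi.1 h).1
      · have := (hc (i - n) (by omega) (by omega)).2
        rwa [show n + (i - n) = i by omega] at this
    rw [Finset.sum_congr rfl hall, Finset.sum_const, Nat.card_Icc, nsmul_eq_mul] at hsum
    obtain ⟨i, hi, hne⟩ := hnz
    rw [hall i hi] at hne
    have : ((2 * n + 1 - 1 : ℕ) : ℝ) ≠ 0 := by
      rw [Nat.add_sub_cancel]; push_cast; positivity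
    exact (mul_ne_zero this hne) hsum
  have hA1 : ∀ i, 1 ≤ i → i ≤ n → lam i ≤ lam 1 := fun i h1 h2 => hmono1 1 i le_rfl h1 h2
  have hAn : ∀ i, 1 ≤ i → i ≤ n → lam n ≤ lam i := fun i h1 h2 => hmono1 i n h1 h2 le_rfl
  have hB1 : ∀ i, 1 ≤ i → i ≤ n → lam (n + i) ≤ lam (n + 1) := fun i h1 h2 =>
    hmono3 (n + 1) (n + i) le_rfl (by omega) (by omega)
  have hBn : ∀ i, 1 ≤ i → i ≤ n → lam (n + n) ≤ lam (n + i) := fun i h1 h2 =>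
    hmono3 (n + i) (n + n) (by omega) (by omega) (by omega)
  rw [two_mul] at hmono2
  obtain ⟨x', hx'⟩ := hint 1 le_rfl (by omega)
  obtain ⟨z', hz'⟩ := hint n (by omega) le_rfl
  obtain ⟨x, hx⟩ : ∃ x : ℤ, lam (n + 1) - lam 1 = x := ⟨-x', by push_cast; linarith⟩
  obtain ⟨z, hz⟩ : ∃ z : ℤ, lam (n + n) - lam n = z := ⟨-z', by push_cast; linarith⟩
  have h1n := hrel' 1 n le_rfl (by omega) le_rfl
  have hx0 : (0 : ℝ) ≤ x := by linarith [hB1 n (by omega) le_rfl]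
  have hz0 : (0 : ℝ) ≤ z := by linarith [hA1 n (by omega) le_rfl]
  have hx1 : 1 ≤ x := by
    by_contra! h
    have h0 : x = 0 := le_antisymm (by omega) (by exact_mod_cast hx0)
    rw [h0, Int.cast_zero] at hx
    refine hnonconst ⟨lam 1, fun i h1 h2 => ⟨?_, ?_⟩⟩
    · rcases h1.eq_or_lt with rfl | h1
      · rfl
      · have := hrel' 1 i le_rfl h1 h2
        rw [hx, zero_mul] at this
        linarith
    · linarith [hB1 i h1 h2, hBn i h1 h2]
  have hz1 : 1 ≤ z := by
    by_contra! h
    have h0 : z = 0 := le_antisymm (by omega) (by exact_mod_cast hz0)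
    rw [h0, Int.cast_zero] at hz
    refine hnonconst ⟨lam n, fun i h1 h2 => ⟨?_, ?_⟩⟩
    · linarith [hA1 i h1 h2, hAn i h1 h2]
    · rcases h2.eq_or_lt with rfl | h2
      · linarith
      · have := hrel' i n h1 h2 le_rfl
        rw [hz, mul_zero] at this
        linarith
  have hle : (x - 1) * (z - 1) ≤ 1 := by
    rw [hx, hz] at h1n
    have : ((x : ℝ) - 1) * (z - 1) ≤ 1 := by linarith
    exact_mod_cast this
  have hmid : ∀ j, 1 < j → j < n →
      (lam (n + j) - lam j) * ((x : ℝ) + z - 1) = x * z := by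
    intro j h1 h2
    have e1 := hrel' 1 j le_rfl h1 h2.le
    have e2 := hrel' j n h1.le h2 le_rfl
    rw [hx] at e1 h1n
    rw [hz] at e2 h1n
    linear_combination e1 + e2 - h1n
  have hxz : x = 1 ∨ z = 1 := by
    obtain ⟨y, hy⟩ := hint 2 (by omega) (by omega)
    refine eq_one_or_eq_one_of_mul_sub_one (y := -y) hx1 hz1 hle ?_
    have := hmid 2 (by omega) (by omega)
    rw [show lam (n + 2) - lam 2 = -(y : ℝ) by linarith] at this
    exact_mod_cast this
  have hxR : (1 : ℝ) ≤ x := by exact_mod_cast hx1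
  have hzR : (1 : ℝ) ≤ z := by exact_mod_cast hz1
  rw [sum_Icc_one_two_mul] at hsum
  obtain ⟨p, rfl⟩ : ∃ p, n = p + 1 := ⟨n - 1, by omega⟩
  rcases hxz with h | h
  · obtain ⟨k, hk⟩ : ∃ k : ℕ, z = k + 1 := ⟨(z - 1).toNat, by omega⟩
    subst h hk
    push_cast at *
    have hm : ∀ j, 1 ≤ j → j < p + 1 → lam j = lam 1 ∧ lam (p + 1 + j) = lam 1 + 1 := by
      intro j h1 h2
      rcases h1.eq_or_lt with rfl | h1
      · exact ⟨rfl, by linarith⟩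
      · have hj : lam (p + 1 + j) - lam j = 1 := by
          refine mul_right_cancel₀ (b := (k : ℝ) + 1) (by positivity) ?_
          linear_combination hmid j h1 h2
        have e := hrel' 1 j le_rfl h1 h2.le
        rw [hx, hj] at e
        constructor <;> linarith
    rw [hx, hz] at h1n
    have hn' : lam (p + 1) = lam 1 - k := by linarith
    rw [Finset.sum_range_succ, Finset.sum_congr rfl (g := fun _ => lam 1 + (lam 1 + 1))
      (fun i hi => by
        rw [Finset.mem_range] at hi
        rw [(hm (i + 1) (by omega) (by omega)).1, (hm (i + 1) (by omega) (by omega)).2]),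
      Finset.sum_const, Finset.card_range, nsmul_eq_mul] at hsum
    have ha : lam 1 = -(((p : ℝ) + 1 - k) / (2 * (p + 1))) := by
      field_simp
      linarith
    have hb : lam 1 + 1 = ((p : ℝ) + 1 + k) / (2 * (p + 1)) := by
      rw [ha]; field_simp; ring
    refine ⟨k, Or.inr ⟨fun i h1 h2 => ?_, ?_, fun j h1 h2 => ?_⟩⟩
    · rw [(hm i h1 (by omega)).1, ha]
    · rw [hn', ha]
    · rw [← hb]
      rcases h2.eq_or_lt with rfl | h2
      · linarith
      · exact (hm j h1 h2).2
  · obtain ⟨k, hk⟩ : ∃ k : ℕ, x = k + 1 := ⟨(x - 1).toNat, by omega⟩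
    subst h hk
    push_cast at *
    have hm : ∀ j, 2 ≤ j → j ≤ p + 1 → lam j = lam 1 ∧ lam (p + 1 + j) = lam 1 + 1 := by
      intro j h1 h2
      have hj : lam (p + 1 + j) - lam j = 1 := by
        rcases h2.eq_or_lt with rfl | h2
        · exact hz
        · refine mul_right_cancel₀ (b := (k : ℝ) + 1) (by positivity) ?_
          linear_combination hmid j h1 h2
      have e := hrel' 1 j le_rfl h1 h2
      rw [hx, hj] at e
      constructor <;> linarith
    rw [Finset.sum_range_succ', Finset.sum_congr rfl (g := fun _ => lam 1 + (lam 1 + 1))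
      (fun i hi => by
        rw [Finset.mem_range] at hi
        rw [(hm (i + 1 + 1) (by omega) (by omega)).1, (hm (i + 1 + 1) (by omega) (by omega)).2]),
      Finset.sum_const, Finset.card_range, nsmul_eq_mul, zero_add] at hsum
    have ha : lam 1 = -(((p : ℝ) + 1 + k) / (2 * (p + 1))) := by
      field_simp
      linarith
    have hb : lam 1 + 1 = ((p : ℝ) + 1 - k) / (2 * (p + 1)) := by
      rw [ha]; field_simp; ring
    refine ⟨k, Or.inl ⟨fun i h1 h2 => ?_, ?_, fun j h1 h2 => ?_⟩⟩
    · rw [← ha]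
      rcases h1.eq_or_lt with rfl | h1
      · rfl
      · exact (hm i h1 h2).1
    · rw [← hb]; linarith
    · rw [← hb, (hm j h1 h2).2]
end

section
/- Let n ≥ 2 and let λ_1, …, λ_{2n} be real numbers such that λ_n ≤ λ_{n−1} ≤ … ≤ λ_1 ≤ λ_{2n} ≤ λ_{2n−1} ≤ … ≤ λ_{n+1} and (λ_i − λ_{n+i})(λ_j − λ_{n+j}) = −(λ_j − λ_{n+i}) for all 1 ≤ i < j ≤ n. If λ_{i₀} − λ_{n+i₀} = 0 for some index 1 ≤ i₀ ≤ n, then λ_1 = λ_2 = … = λ_{2n}. -/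
/-- Intermediate step in the case `J = H_n(ℂ)`, `co(J) = su(n, n)`: under the unitarity
chain `λ_n ≤ … ≤ λ_1 ≤ λ_{2n} ≤ … ≤ λ_{n+1}` and the quadratic relation
`(λ_i − λ_{n+i})(λ_j − λ_{n+j}) = −(λ_j − λ_{n+i})` (for `1 ≤ i < j ≤ n`), if
`λ_{i₀} − λ_{n+i₀} = 0` for some `1 ≤ i₀ ≤ n`, then all the `λ_i` are equal. -/
theorem stmt15 (n : ℕ) (hn : 2 ≤ n) (lam : ℕ → ℝ)
    (hmono1 : ∀ i j, 1 ≤ i → i ≤ j → j ≤ n → lam j ≤ lam i)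
    (hmono2 : lam 1 ≤ lam (2 * n))
    (hmono3 : ∀ i j, n + 1 ≤ i → i ≤ j → j ≤ 2 * n → lam j ≤ lam i)
    (hrel : ∀ i j, 1 ≤ i → i < j → j ≤ n →
      (lam i - lam (n + i)) * (lam j - lam (n + j)) = -(lam j - lam (n + i)))
    (i₀ : ℕ) (hi₀ : 1 ≤ i₀) (hi₀n : i₀ ≤ n)
    (hzero : lam i₀ - lam (n + i₀) = 0) :
    ∀ i ∈ Finset.Icc 1 (2 * n), ∀ j ∈ Finset.Icc 1 (2 * n), lam i = lam j := by
  have hconst : ∀ k, 1 ≤ k → k ≤ n → lam k = lam i₀ ∧ lam (n + k) = lam i₀ := by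
    intro k hk hkn
    have ha1 := hmono1 1 k le_rfl hk hkn
    have hb1 := hmono3 (n + k) (2 * n) (by omega) (by omega) le_rfl
    have ha2 := hmono1 1 i₀ le_rfl hi₀ hi₀n
    have hb2 := hmono3 (n + i₀) (2 * n) (by omega) (by omega) le_rfl
    rcases lt_trichotomy k i₀ with h | rfl | h
    · have hr := hrel k i₀ hk h hi₀n
      rw [hzero, mul_zero] at hr
      have ha := hmono1 k i₀ hk h.le hi₀n
      constructor <;> linarith
    · constructor <;> linarith
    · have hr := hrel i₀ k hi₀ h hkn
      rw [hzero, zero_mul] at hr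
      have hb := hmono3 (n + i₀) (n + k) (by omega) (by omega) (by omega)
      constructor <;> linarith
  have hall : ∀ i ∈ Finset.Icc 1 (2 * n), lam i = lam i₀ := by
    intro i hi
    rw [Finset.mem_Icc] at hi
    rcases le_or_gt i n with h | h
    · exact (hconst i hi.1 h).1
    · have := (hconst (i - n) (by omega) (by omega)).2
      rwa [Nat.add_sub_cancel' h.le] at this
  intro i hi j hj
  rw [hall i hi, hall j hj]
end

section
/- Let n ≥ 3 and let λ_1, …, λ_{2n} be real numbers such that: (i) λ_{2n} ≤ λ_{2n−1} ≤ … ≤ λ_{n+1} ≤ λ_n ≤ λ_{n−1} ≤ … ≤ λ_2 ≤ −|λ_1|; (ii) for every 1 ≤ i ≤ n, s_i := λ_i + λ_{n+i} is an integer with s_i ≤ −1; (iii) s_i·s_j = −(λ_j + λ_{n+i} + 2λ_{n+j}) for all 1 ≤ i < j ≤ n; (iv) (λ_1 + λ_2 + λ_{n+1} + λ_{n+2})·(n + 1 + Σ_{i=1}^{n} s_i) + 2·Σ_{i=1}^{n} (λ_i + 2λ_{n+i}) − (λ_1 − λ_2 − λ_{n+1} + λ_{n+2})² − (n+1)λ_1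 − (n−3)λ_2 − 5λ_{n+1} − λ_{n+2} = 0. Then λ_i + λ_{n+i} = −2 for every 1 ≤ i ≤ n−1. -/
/-- Key lemma in the case `J = H_n(ℍ)`, `co(J) = so*(4n)`: under the unitarity chain
`λ_{2n} ≤ … ≤ λ_{n+1} ≤ λ_n ≤ … ≤ λ_2 ≤ −|λ_1|`, the integrality/nontriviality
condition that each `s_i := λ_i + λ_{n+i}` is an integer `≤ −1`, the quadratic
relation `s_i s_j = −(λ_j + λ_{n+i} + 2λ_{n+j})`, and the relation (iv) from (Q4),
one has `λ_i + λ_{n+i} = −2` for all `1 ≤ i ≤ n−1`. -/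
theorem stmt16 (n : ℕ) (hn : 3 ≤ n) (lam : ℕ → ℝ)
    (hmono : ∀ i j, 2 ≤ i → i ≤ j → j ≤ 2 * n → lam j ≤ lam i)
    (habs : lam 2 ≤ -|lam 1|)
    (hint : ∀ i, 1 ≤ i → i ≤ n →
      ∃ z : ℤ, lam i + lam (n + i) = z ∧ (z : ℝ) ≤ -1)
    (hrel : ∀ i j, 1 ≤ i → i < j → j ≤ n →
      (lam i + lam (n + i)) * (lam j + lam (n + j))
        = -(lam j + lam (n + i) + 2 * lam (n + j)))
    (h4 : (lam 1 + lam 2 + lam (n + 1) + lam (n + 2))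
          * ((n : ℝ) + 1 + ∑ i ∈ Finset.Icc 1 n, (lam i + lam (n + i)))
        + 2 * ∑ i ∈ Finset.Icc 1 n, (lam i + 2 * lam (n + i))
        - (lam 1 - lam 2 - lam (n + 1) + lam (n + 2)) ^ 2
        - ((n : ℝ) + 1) * lam 1 - ((n : ℝ) - 3) * lam 2
        - 5 * lam (n + 1) - lam (n + 2) = 0) :
    ∀ i, 1 ≤ i → i ≤ n - 1 → lam i + lam (n + i) = -2 := by
  have hmono' : ∀ i j, 1 ≤ i → i ≤ j → j ≤ 2 * n → lam j ≤ lam i := by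
    intro i j hi hij hj
    rcases Nat.lt_or_ge 1 i with h | h
    · exact hmono i j h hij hj
    · obtain rfl : i = 1 := by omega
      rcases Nat.lt_or_ge 1 j with h' | h'
      · exact (hmono 2 j le_rfl h' hj).trans (habs.trans (neg_abs_le _))
      · obtain rfl : j = 1 := by omega
        exact le_rfl
  have hlam2 : lam 2 ≤ 0 := habs.trans (neg_nonpos.2 (abs_nonneg _))
  have hs_neg : ∀ i, 1 ≤ i → i ≤ n → lam i + lam (n + i) ≤ -1 := by
    intro i hi hin
    obtain ⟨z, hz, hz'⟩ := hint i hi hin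
    rwa [hz]
  have hs1 : lam 1 + lam (n + 1) ≤ -2 := by
    obtain ⟨z, hz, hz'⟩ := hint 1 le_rfl (by omega)
    have hz1 : z ≤ -1 := by exact_mod_cast hz'
    have hne : z ≠ -1 := by
      rintro rfl
      push_cast at hz
      have hr := hrel 1 2 le_rfl (by omega) (by omega)
      rw [hz] at hr
      have h2 := hs_neg 2 (by omega) (by omega)
      have h3 := hmono 2 (n + 1) le_rfl (by omega) (by omega)
      have h5 := hmono (n + 1) (n + 2) (by omega) (by omega) (by omega)
      linarith
    rw [hz]
    exact_mod_cast (by omega : z ≤ -2)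
  have hsn : lam n + lam (n + n) ≤ -2 := by
    have h1 := hmono' 1 n le_rfl (by omega) (by omega)
    have h2 := hmono' (n + 1) (n + n) (by omega) (by omega) (by omega)
    linarith
  have hs_eq : ∀ i, 1 ≤ i → i < n → lam i + lam (n + i) = lam 1 + lam (n + 1) := by
    intro i hi hin
    rcases Nat.lt_or_ge 1 i with h | h
    · have h1 := hmono' 1 i le_rfl hi (by omega)
      have h2 := hmono' (n + 1) (n + i) (by omega) (by omega) (by omega)
      have r1 := hrel 1 n le_rfl (by omega) le_rfl
      have r2 := hrel i n hi hin le_rfl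
      nlinarith
    · obtain rfl : i = 1 := by omega
      rfl
  have hlam_eq : ∀ i, 1 ≤ i → i < n → lam i = lam 1 ∧ lam (n + i) = lam (n + 1) := by
    intro i hi hin
    have h1 := hmono' 1 i le_rfl hi (by omega)
    have h2 := hmono' (n + 1) (n + i) (by omega) (by omega) (by omega)
    have h3 := hs_eq i hi hin
    constructor <;> linarith
  obtain ⟨ha2, hm2⟩ := hlam_eq 2 (by omega) (by omega)
  have r12 := hrel 1 2 le_rfl (by omega) (by omega)
  have r1n := hrel 1 n le_rfl (by omega) le_rfl
  rw [ha2, hm2] at r12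
  have hs_two : lam 1 + lam (n + 1) = -2 := by
    by_contra hne
    have hs3 : lam 1 + lam (n + 1) = -3 := by
      obtain ⟨z, hz, -⟩ := hint 1 le_rfl (by omega)
      have hge : -3 ≤ lam 1 + lam (n + 1) := by nlinarith
      rw [hz] at hs1 hge hne ⊢
      have k1 : z ≤ -2 := by exact_mod_cast hs1
      have k2 : -3 ≤ z := by exact_mod_cast hge
      have k3 : z ≠ -2 := by exact_mod_cast hne
      exact_mod_cast (by omega : z = -3)
    rw [hs3] at r12 r1n
    have ha1 : lam 1 = 0 := by linarith
    have hm1 : lam (n + 1) = -3 := by linarith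
    have han : lam n = 0 ∧ lam (n + n) = -3 := by
      have h1 := hmono' 1 n le_rfl (by omega) (by omega)
      have h2 := hmono' (n + 1) (n + n) (by omega) (by omega) (by omega)
      constructor <;> linarith
    have hall : ∀ i ∈ Finset.Icc 1 n, lam i = 0 ∧ lam (n + i) = -3 := by
      intro i hi
      rw [Finset.mem_Icc] at hi
      rcases hi.2.lt_or_eq with h | rfl
      · obtain ⟨h1, h2⟩ := hlam_eq i hi.1 h
        exact ⟨h1.trans ha1, h2.trans hm1⟩
      · exact han
    have hS : ∑ i ∈ Finset.Icc 1 n, (lam i + lam (n + i)) = n * (-3 : ℝ) := by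
      rw [Finset.sum_congr rfl fun i hi ↦ by rw [(hall i hi).1, (hall i hi).2]]
      norm_num
    have hT : ∑ i ∈ Finset.Icc 1 n, (lam i + 2 * lam (n + i)) = n * (-6 : ℝ) := by
      rw [Finset.sum_congr rfl fun i hi ↦ by rw [(hall i hi).1, (hall i hi).2]]
      norm_num
    rw [hS, hT, ha2, hm2, ha1, hm1] at h4
    linarith
  intro i hi hin
  rw [hs_eq i hi (by omega), hs_two]
end

section
/- Let n ≥ 3 and let λ_1, …, λ_{2n} be real numbers such that: (i) λ_{2n} ≤ λ_{2n−1} ≤ … ≤ λ_{n+1} ≤ λ_n ≤ λ_{n−1} ≤ … ≤ λ_2 ≤ −|λ_1|; (ii) for every 1 ≤ i ≤ n, s_i := λ_i + λ_{n+i} is an integer with s_i ≤ −1; (iii) s_i·s_j = −(λ_j + λ_{n+i} + 2λ_{n+j}) for all 1 ≤ i < j ≤ n; (iv) (λ_1 + λ_2 + λ_{n+1} + λ_{n+2})·(n + 1 + Σ_{i=1}^{n} s_i) + 2·Σ_{i=1}^{n} (λ_i + 2λ_{n+i}) − (λ_1 − λ_2 − λ_{n+1} + λ_{n+2})² − (n+1)λ_1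 − (n−3)λ_2 − 5λ_{n+1} − λ_{n+2} = 0. Then λ_1 = λ_2 = … = λ_{2n−1} = −1, and λ_{2n} = −1 − k for some nonnegative integer k. -/
/-- Determination of the highest weight in the case `J = H_n(ℍ)`, `co(J) = so*(4n)`:
under the unitarity chain `λ_{2n} ≤ … ≤ λ_{n+1} ≤ λ_n ≤ … ≤ λ_2 ≤ −|λ_1|`, the
integrality/nontriviality condition that each `s_i := λ_i + λ_{n+i}` is an integer
`≤ −1`, the quadratic relation `s_i s_j = −(λ_j + λ_{n+i} + 2λ_{n+j})`, and the
relation (iv) from (Q4), one has `λ_1 = … = λ_{2n−1} = −1` and `λ_{2n} = −1 − k`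
for some nonnegative integer `k`. -/
theorem stmt17 (n : ℕ) (hn : 3 ≤ n) (lam : ℕ → ℝ)
    (hmono : ∀ i j, 2 ≤ i → i ≤ j → j ≤ 2 * n → lam j ≤ lam i)
    (habs : lam 2 ≤ -|lam 1|)
    (hint : ∀ i, 1 ≤ i → i ≤ n →
      ∃ z : ℤ, lam i + lam (n + i) = z ∧ (z : ℝ) ≤ -1)
    (hrel : ∀ i j, 1 ≤ i → i < j → j ≤ n →
      (lam i + lam (n + i)) * (lam j + lam (n + j))
        = -(lam j + lam (n + i) + 2 * lam (n + j)))
    (h4 : (lam 1 + lam 2 + lam (n + 1) + lam (n + 2))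
          * ((n : ℝ) + 1 + ∑ i ∈ Finset.Icc 1 n, (lam i + lam (n + i)))
        + 2 * ∑ i ∈ Finset.Icc 1 n, (lam i + 2 * lam (n + i))
        - (lam 1 - lam 2 - lam (n + 1) + lam (n + 2)) ^ 2
        - ((n : ℝ) + 1) * lam 1 - ((n : ℝ) - 3) * lam 2
        - 5 * lam (n + 1) - lam (n + 2) = 0) :
    (∀ i, 1 ≤ i → i ≤ 2 * n - 1 → lam i = -1) ∧
      ∃ k : ℕ, lam (2 * n) = -1 - k := by
  have h12 := hrel 1 2 le_rfl (by omega) (by omega)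
  have h13 := hrel 1 3 le_rfl (by omega) (by omega)
  have h23 := hrel 2 3 (by omega) (by omega) (by omega)
  have hle_two : ∀ j, 2 ≤ j → j ≤ n → lam j ≤ lam 2 := fun j h h' =>
    hmono 2 j le_rfl h (by omega)
  have hba : lam (n + 1) ≤ lam 2 := hmono 2 (n + 1) le_rfl (by omega) (by omega)
  have hb12 := hmono (n + 1) (n + 2) (by omega) (by omega) (by omega)
  have hb23 := hmono (n + 2) (n + 3) (by omega) (by omega) (by omega)
  have ha23 := hle_two 3 (by omega) hn
  have ha12 : lam 2 ≤ lam 1 := by linarith [neg_abs_le (lam 1)]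
  have hneg : lam 2 ≤ -lam 1 := by linarith [le_abs_self (lam 1)]
  obtain ⟨z, hz, hz1⟩ := hint 1 le_rfl (by omega)
  -- The first two sums coincide.
  have hs : lam 1 + lam (n + 1) = lam 2 + lam (n + 2) := by
    by_contra hne
    have hlt : lam 2 + lam (n + 2) < lam 1 + lam (n + 1) :=
      lt_of_le_of_ne (by linarith) (Ne.symm hne)
    nlinarith [mul_pos (sub_pos.2 hlt)
      (show 0 < -1 - (lam 3 + lam (n + 3)) by linarith)]
  have hb : lam (n + 2) = lam (n + 1) := by
    rw [hs] at h13
    linarith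
  have ha : lam 2 = lam 1 := by linarith
  have hb1 : 2 * lam (n + 1) = -(z : ℝ) * (z + 1) := by
    rw [← hs, hz] at h12
    linarith
  -- The common value of these sums is `-2` or `-3`.
  have hz2 : z = -2 ∨ z = -3 := by
    have h_le : z ≤ -1 := by exact_mod_cast hz1
    have h_ne : z ≠ -1 := by
      rintro rfl
      norm_num at hb1 hz
      linarith
    have h_lower : -3 ≤ z := by
      have : (-3 : ℝ) ≤ z := by nlinarith
      exact_mod_cast this
    omega
  rcases hz2 with rfl | rfl
  · push_cast at hb1 hz
    have hb1' : lam (n + 1) = -1 := by linarith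
    have ha1 : lam 1 = -1 := by linarith
    have haj : ∀ j, 1 ≤ j → j ≤ n → lam j = -1 := by
      intro j hj hjn
      obtain rfl | hj1 := hj.eq_or_lt
      · exact ha1
      · have h := hrel 1 j le_rfl hj1 hjn
        rw [hz] at h
        linarith
    have hbj : ∀ j, 1 ≤ j → j < n → lam (n + j) = -1 := by
      intro j hj hjn
      obtain rfl | hj1 := hj.eq_or_lt
      · exact hb1'
      · have h := hrel j n hj hjn le_rfl
        have hbn := hmono (n + 1) (n + n) (by omega) (by omega) (by omega)
        rw [haj j hj hjn.le, haj n (by omega) le_rfl] at h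
        have h0 : lam (n + n) * (lam (n + j) + 1) = 0 := by linarith
        rcases mul_eq_zero.1 h0 with h0 | h0 <;> linarith
    refine ⟨fun i hi hin => ?_, ?_⟩
    · rcases le_or_gt i n with h | h
      · exact haj i hi h
      · obtain ⟨j, rfl⟩ := Nat.exists_eq_add_of_le h.le
        exact hbj j (by omega) (by omega)
    · obtain ⟨w, hw, -⟩ := hint n (by omega) le_rfl
      have hbn := hmono (n + 1) (n + n) (by omega) (by omega) (by omega)
      rw [haj n (by omega) le_rfl] at hw
      have hw2 : w ≤ -2 := by
        have : (w : ℝ) ≤ -2 := by linarith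
        exact_mod_cast this
      obtain ⟨k, hk⟩ := Int.eq_ofNat_of_zero_le (show 0 ≤ -2 - w by omega)
      have hk' : (-2 - w : ℝ) = k := by exact_mod_cast hk
      exact ⟨k, by rw [two_mul]; linarith⟩
  · exfalso
    push_cast at hb1 hz
    have hb1' : lam (n + 1) = -3 := by linarith
    have ha1 : lam 1 = 0 := by linarith
    have hj : ∀ j ∈ Finset.Icc 1 n, lam j = 0 ∧ lam (n + j) = -3 := by
      intro j hj
      obtain ⟨hj, hjn⟩ := Finset.mem_Icc.1 hj
      obtain rfl | hj1 := hj.eq_or_lt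
      · exact ⟨ha1, hb1'⟩
      · have h := hrel 1 j le_rfl hj1 hjn
        rw [hz] at h
        have h1 := hle_two j hj1 hjn
        have h2 := hmono (n + 1) (n + j) (by omega) (by omega) (by omega)
        constructor <;> linarith
    have hsum1 : ∑ i ∈ Finset.Icc 1 n, (lam i + lam (n + i)) = n * (-3) := by
      rw [Finset.sum_congr rfl fun i hi => by rw [(hj i hi).1, (hj i hi).2]]
      simp
    have hsum2 : ∑ i ∈ Finset.Icc 1 n, (lam i + 2 * lam (n + i)) = n * (-6) := by
      rw [Finset.sum_congr rfl fun i hi => by rw [(hj i hi).1, (hj i hi).2]]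
      norm_num
    rw [hsum1, hsum2, hb, ha, hb1', ha1] at h4
    linarith
end

section
/- Let λ_1, …, λ_8 be real numbers such that: (i) −λ_6 ≥ λ_5 ≥ λ_4 ≥ λ_3 ≥ λ_2 ≥ |λ_1| ≥ 0; (ii) λ_8 = −λ_7 and λ_7 ≥ 0; (iii) λ_6·(4 − 2λ_7) = 0; (iv) λ_7·(4 + λ_6) = 0; (v) (2λ_6 + λ_8 − λ_7)² − (λ_6 − λ_3)² − (λ_6 + λ_3)² − (λ_8 − λ_7)² + 24λ_6 − 4λ_3 − 2λ_4 − 2λ_5 = 0; (vi) λ_6 < 0. Then (λ_1, λ_2, λ_3, λ_4, λ_5, λ_6, λ_7, λ_8) = (0, 0, 0, 0, 0, −4, 2, −2). -/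
/-- Determination of the highest weight in the exceptional case `J = H_3(𝕆)`,
`co(J) = e_{7(−25)}`: under the unitarity conditions (i)–(ii), the relations
(iii)–(iv) from (Q3) and (Q4), the relation (v) from (Q2), and nontriviality
`λ_6 < 0`, the highest weight is `(0, 0, 0, 0, 0, −4, 2, −2)`. -/
theorem stmt18 (l1 l2 l3 l4 l5 l6 l7 l8 : ℝ)
    (h1 : -l6 ≥ l5) (h2 : l5 ≥ l4) (h3 : l4 ≥ l3) (h4 : l3 ≥ l2)
    (h5 : l2 ≥ |l1|)
    (h6 : l8 = -l7) (h7 : 0 ≤ l7)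
    (h8 : l6 * (4 - 2 * l7) = 0)
    (h9 : l7 * (4 + l6) = 0)
    (h10 : (2 * l6 + l8 - l7) ^ 2 - (l6 - l3) ^ 2 - (l6 + l3) ^ 2 - (l8 - l7) ^ 2
        + 24 * l6 - 4 * l3 - 2 * l4 - 2 * l5 = 0)
    (h11 : l6 < 0) :
    l1 = 0 ∧ l2 = 0 ∧ l3 = 0 ∧ l4 = 0 ∧ l5 = 0 ∧ l6 = -4 ∧ l7 = 2 ∧ l8 = -2 := by
  have hl7 : l7 = 2 := by
    rcases mul_eq_zero.mp h8 with h | h <;> linarith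
  subst hl7
  have hl6 : l6 = -4 := by linarith
  subst hl6 h6
  have hl1 := abs_nonneg l1
  have hl3 : l3 = 0 := by nlinarith [sq_nonneg l3]
  subst hl3
  have hl1' : |l1| = 0 := by linarith
  refine ⟨abs_eq_zero.mp hl1', ?_, rfl, ?_, ?_, rfl, rfl, rfl⟩ <;> linarith
end
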